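/- Let H be an N×N hermitian Wigner matrix satisfying condition C1. For any κ > 0 and K > 0 there exist constants C = C(κ,K) and c = c(κ,K) such that for any interval I ⊂ [−2+κ, 2−κ] of length |I| ≤ K/N, one has P( there exists a unit vector v with Hv = μv for some μ ∈ I and |v₁| ≥ M N^{−1/2} ) ≤ C e^{−c√M} for all M ≥ 0 and all N ≥ 2, where v₁ denotes the first coordinate of v. -/

import Mathlib

open MeasureTheory ProbabilityTheory
open scoped ENNReal NNReal

noncomputable section

/-- The density of the Wigner semicircle law. -/
def rhoSC (x : ℝ) : ℝ := if |x| ≤ 2 then Real.sqrt (4 - x ^ 2) / (2 * Real.pi) else 0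

/-- The Stieltjes transform of the Wigner semicircle law. -/
def mSC (z : ℂ) : ℂ := ∫ x : ℝ, (rhoSC x : ℂ) / ((x : ℂ) - z)

/-- The Stieltjes transform of the empirical eigenvalue distribution of a matrix:
`m(z) = N⁻¹ Tr (H - z)⁻¹`. -/
def stTrans {N : ℕ} (A : Matrix (Fin N) (Fin N) ℂ) (z : ℂ) : ℂ :=
  (Matrix.trace (A - z • (1 : Matrix (Fin N) (Fin N) ℂ))⁻¹) / (N : ℂ)

open scoped Classical in
/-- The number of eigenvalues (with multiplicity) of a Hermitian matrix lying in a set `I`. -/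
def eigCount {N : ℕ} {A : Matrix (Fin N) (Fin N) ℂ} (hA : A.IsHermitian) (I : Set ℝ) : ℕ :=
  (Finset.univ.filter fun i => hA.eigenvalues i ∈ I).card

/-- `ν` has a strictly positive density `h` on `ℝ² ≃ ℂ` which is either a product of two copies
of a one-variable function or radially symmetric. -/
def WignerDensityOf (ν : Measure ℂ) (h : ℝ → ℝ → ℝ) : Prop :=
  (∀ x y, 0 < h x y) ∧
  ν = (volume : Measure ℂ).withDensity (fun z => ENNReal.ofReal (h z.re z.im)) ∧
  ((∃ hs : ℝ → ℝ, ∀ x y, h x y = hs x * hs y) ∨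
   (∃ hs : ℝ → ℝ, ∀ x y, h x y = hs (x ^ 2 + y ^ 2)))

/-- Condition C1, with explicit constants: Gaussian moments of the off-diagonal law `ν`
and of the diagonal law `ν'` are bounded by `D` resp. `D'`. -/
def CondC1 (ν : Measure ℂ) (ν' : Measure ℝ) (δ₀ D D' : ℝ) : Prop :=
  0 < δ₀ ∧
  (∫⁻ z, ENNReal.ofReal (Real.exp (δ₀ * ‖z‖ ^ 2)) ∂ν) ≤ ENNReal.ofReal D ∧
  (∫⁻ x, ENNReal.ofReal (Real.exp (δ₀ * x ^ 2)) ∂ν') ≤ ENNReal.ofReal D'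

/-- `H` is an `N × N` hermitian Wigner ensemble on the probability space `(Ω, P)`:
the entries above the diagonal are i.i.d. with law `N^{-1/2} ν` where `ν` has mean zero,
variance one and a density as in `WignerDensityOf`; the diagonal entries are real i.i.d.
with law `N^{-1/2} ν'`, `ν'` of mean zero; and all these entries are independent. -/
structure IsWignerMatrix {Ω : Type} [MeasurableSpace Ω] (P : Measure Ω) (N : ℕ)
    (H : Ω → Matrix (Fin N) (Fin N) ℂ) (ν : Measure ℂ) (ν' : Measure ℝ) : Prop where
  herm : ∀ ω, (H ω).IsHermitian
  prob : IsProbabilityMeasure P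
  probν : IsProbabilityMeasure ν
  probν' : IsProbabilityMeasure ν'
  density : ∃ h, WignerDensityOf ν h
  mean : (∫ z, z ∂ν) = 0
  var : (∫ z, ‖z‖ ^ 2 ∂ν) = 1
  mean' : (∫ x, x ∂ν') = 0
  offdiag : ∀ i j : Fin N, i < j →
    P.map (fun ω => (Real.sqrt N : ℂ) * H ω i j) = ν
  diag : ∀ i : Fin N, P.map (fun ω => Real.sqrt N * (H ω i i).re) = ν'
  diag_real : ∀ ω i, (H ω i i).im = 0
  indep : iIndepFun (m := fun _ => inferInstance)
    (fun (p : {p : Fin N × Fin N // p.1 ≤ p.2}) (ω : Ω) => H ω p.1.1 p.1.2) P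
/-- The Fourier transform on `ℝ²` of a real function of two variables. -/
def fourier2 (f : ℝ → ℝ → ℝ) (t s : ℝ) : ℂ :=
  ∫ x : ℝ, ∫ y : ℝ, Complex.exp (-Complex.I * (t * x + s * y)) * (f x y : ℂ)

/-- The Laplacian of a function of two real variables. -/
def laplacian2 (g : ℝ → ℝ → ℝ) (x y : ℝ) : ℝ :=
  deriv (deriv (fun t => g t y)) x + deriv (deriv (fun t => g x t)) y

/-- Condition C2 with exponent `a` and constants `w`, `w'`: decay of the Fourier transforms
of the density `h` and of `h · Δ(-log h)`. -/
def CondC2 (h : ℝ → ℝ → ℝ) (a : ℕ) (w w' : ℝ) : Prop :=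
  0 < w ∧ 0 < w' ∧
  (∀ t s : ℝ, ‖fourier2 h t s‖ ≤ 1 / (1 + w * (t ^ 2 + s ^ 2)) ^ a) ∧
  (∀ t s : ℝ, ‖fourier2
      (fun x y => h x y * laplacian2 (fun u v => -Real.log (h u v)) x y) t s‖
    ≤ 1 / (1 + w' * (t ^ 2 + s ^ 2)) ^ a)

/-- Either the real and imaginary parts under `ν` are i.i.d., or `ν` is rotationally
symmetric. -/
def ComplexSymm (ν : Measure ℂ) : Prop :=
  (∃ μ₀ : Measure ℝ,
    ν = Measure.map (fun p : ℝ × ℝ => (p.1 : ℂ) + p.2 * Complex.I) (μ₀.prod μ₀)) ∨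
  (∀ θ : ℝ, Measure.map (fun z => Complex.exp (θ * Complex.I) * z) ν = ν)

set_option linter.unusedSectionVars false

theorem real_aux1 {η x y s P Q : ℝ} (hη : 0 < η) (hx : 0 ≤ x) (hy : 0 ≤ y) (hs : 0 ≤ s)
    (hP : 0 ≤ P) (hQ : 0 ≤ Q) (hd : x - y ≤ η * s) (h1 : s ^ 2 ≤ P * Q) (hPx : η * P ≤ x)
    (hQy : 2 * η * Q ≤ y) : x ≤ 2 * y := by
  have h4 : (η * s) ^ 2 * 2 ≤ x * y := by
    calc (η * s) ^ 2 * 2 = 2 * η ^ 2 * s ^ 2 := by ring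
      _ ≤ 2 * η ^ 2 * (P * Q) := by gcongr
      _ = (η * P) * (2 * η * Q) := by ring
      _ ≤ x * y := mul_le_mul hPx hQy (by positivity) hx
  by_contra hcon
  push Not at hcon
  have h5 : (x - y) ^ 2 ≤ (η * s) ^ 2 := by
    apply pow_le_pow_left₀ _ hd; linarith
  nlinarith

theorem real_aux2 {η x T P Q : ℝ} (hη : 0 < η) (hx : 0 < x)
    (hP : 0 ≤ P) (hQ : 0 ≤ Q) (h1 : (x * T) ^ 2 ≤ P * Q) (hPx : η * P ≤ x)
    (hQy : η * Q ≤ x) : T ≤ 1 / η := by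
  have h6 : (η * x * T) ^ 2 ≤ x ^ 2 := by
    calc (η * x * T) ^ 2 = η ^ 2 * (x * T) ^ 2 := by ring
      _ ≤ η ^ 2 * (P * Q) := by gcongr
      _ = (η * P) * (η * Q) := by ring
      _ ≤ x * x := mul_le_mul hPx hQy (by positivity) hx.le
      _ = x ^ 2 := by ring
  have h7 := (abs_le_of_sq_le_sq' h6 hx.le).2
  rw [le_div_iff₀ hη]
  by_contra hc
  push Not at hc
  nlinarith

section DetPart
variable {ι : Type*} [Fintype ι] [DecidableEq ι]

/-- resolvent -/
def resol (A : Matrix ι ι ℂ) (z : ℂ) : Matrix ι ι ℂ := (A - z • (1 : Matrix ι ι ℂ))⁻¹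

theorem resol_unit {A : Matrix ι ι ℂ} (hA : A.IsHermitian) {z : ℂ} (hz : z.im ≠ 0) :
    IsUnit (A - z • (1 : Matrix ι ι ℂ)).det := by
  rw [isUnit_iff_ne_zero]
  intro h0
  obtain ⟨v, hv, hv0⟩ := Matrix.exists_mulVec_eq_zero_iff.mpr h0
  rw [Matrix.sub_mulVec, Matrix.smul_mulVec, Matrix.one_mulVec, sub_eq_zero] at hv0
  have h1 := hA.im_star_dotProduct_mulVec_self v
  rw [hv0, dotProduct_smul] at h1
  have h2 : star v ⬝ᵥ v = ((∑ i, ‖v i‖ ^ 2 : ℝ) : ℂ) := by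
    simp only [dotProduct, Pi.star_apply, RCLike.star_def, Complex.conj_mul']
    push_cast; rfl
  rw [h2] at h1
  simp only [smul_eq_mul] at h1
  have h3 : z.im * (∑ i, ‖v i‖ ^ 2 : ℝ) = 0 := by
    have : (z * ((∑ i, ‖v i‖ ^ 2 : ℝ) : ℂ)).im = 0 := h1
    rwa [Complex.im_mul_ofReal] at this
  rcases mul_eq_zero.mp h3 with h | h
  · exact hz h
  · apply hv
    rw [Finset.sum_eq_zero_iff_of_nonneg (fun i _ => by positivity)] at h
    funext i
    have := h i (Finset.mem_univ i)
    simpa using this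

theorem resol_left {A : Matrix ι ι ℂ} (hA : A.IsHermitian) {z : ℂ} (hz : z.im ≠ 0) :
    resol A z * (A - z • (1 : Matrix ι ι ℂ)) = 1 :=
  Matrix.nonsing_inv_mul _ (resol_unit hA hz)

theorem resol_right {A : Matrix ι ι ℂ} (hA : A.IsHermitian) {z : ℂ} (hz : z.im ≠ 0) :
    (A - z • (1 : Matrix ι ι ℂ)) * resol A z = 1 :=
  Matrix.mul_nonsing_inv _ (resol_unit hA hz)

theorem resol_identity {A : Matrix ι ι ℂ} (hA : A.IsHermitian) {z w : ℂ} (hz : z.im ≠ 0)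
    (hw : w.im ≠ 0) : resol A z - resol A w = (z - w) • (resol A z * resol A w) := by
  have h1 : resol A z * ((A - w • (1 : Matrix ι ι ℂ)) - (A - z • (1 : Matrix ι ι ℂ))) * resol A w
      = resol A z - resol A w := by
    rw [mul_sub, sub_mul, resol_left hA hz, mul_assoc, resol_right hA hw, mul_one, one_mul]
  rw [← h1]
  have : (A - w • (1 : Matrix ι ι ℂ)) - (A - z • (1 : Matrix ι ι ℂ))
      = (z - w) • (1 : Matrix ι ι ℂ) := by
    rw [sub_smul]; abel
  rw [this]; simp

theorem resol_star {A : Matrix ι ι ℂ} (hA : A.IsHermitian) (z : ℂ) :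
    (resol A z).conjTranspose = resol A (star z) := by
  unfold resol
  rw [Matrix.conjTranspose_nonsing_inv, Matrix.conjTranspose_sub, hA.eq,
    Matrix.conjTranspose_smul, Matrix.conjTranspose_one]

theorem resol_ward_row {A : Matrix ι ι ℂ} (hA : A.IsHermitian) {z : ℂ} (hz : z.im ≠ 0) (i : ι) :
    z.im * ∑ j, ‖resol A z i j‖ ^ 2 = (resol A z i i).im := by
  have h := resol_identity hA hz (w := star z) (by simpa using hz)
  rw [← resol_star hA] at h
  have h2 := congrFun (congrFun h i) i
  simp only [Matrix.sub_apply, Matrix.conjTranspose_apply, Matrix.smul_apply, Matrix.mul_apply,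
    RCLike.star_def, Complex.mul_conj', smul_eq_mul] at h2
  have h3 := congrArg Complex.im h2
  have e : (∑ x, ((‖resol A z i x‖ : ℂ)) ^ 2) = ((∑ j, ‖resol A z i j‖ ^ 2 : ℝ) : ℂ) := by
    push_cast; rfl
  rw [e, Complex.im_mul_ofReal] at h3
  simp at h3
  linarith

theorem resol_ward_col {A : Matrix ι ι ℂ} (hA : A.IsHermitian) {z : ℂ} (hz : z.im ≠ 0) (i : ι) :
    z.im * ∑ j, ‖resol A z j i‖ ^ 2 = (resol A z i i).im := by
  have h := resol_identity hA (z := star z) (w := z) (by simpa using hz) hz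
  rw [← resol_star hA] at h
  have h2 := congrFun (congrFun h i) i
  simp only [Matrix.sub_apply, Matrix.conjTranspose_apply, Matrix.smul_apply, Matrix.mul_apply,
    RCLike.star_def, Complex.conj_mul', smul_eq_mul] at h2
  have h3 := congrArg Complex.im h2
  have e : (∑ x, ((‖resol A z x i‖ : ℂ)) ^ 2) = ((∑ j, ‖resol A z j i‖ ^ 2 : ℝ) : ℂ) := by
    push_cast; rfl
  rw [e, Complex.im_mul_ofReal] at h3
  simp at h3
  linarith

/-- Cauchy-Schwarz for finite sums of norms of products. -/
theorem norm_sum_mul_le (f g : ι → ℂ) :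
    ‖∑ j, f j * g j‖ ^ 2 ≤ (∑ j, ‖f j‖ ^ 2) * ∑ j, ‖g j‖ ^ 2 := by
  calc ‖∑ j, f j * g j‖ ^ 2 ≤ (∑ j, ‖f j‖ * ‖g j‖) ^ 2 := by
        gcongr
        exact (norm_sum_le _ _).trans (by simp)
    _ ≤ _ := Finset.sum_mul_sq_le_sq_mul_sq _ _ _

theorem resol_diag_le {A : Matrix ι ι ℂ} (hA : A.IsHermitian) {z : ℂ} (hz : 0 < z.im) (i : ι) :
    ‖resol A z i i‖ ≤ 1 / z.im := by
  have h := resol_ward_row hA hz.ne' i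
  have h1 : ‖resol A z i i‖ ^ 2 ≤ ∑ j, ‖resol A z i j‖ ^ 2 :=
    Finset.single_le_sum (f := fun j => ‖resol A z i j‖ ^ 2) (fun j _ => by positivity)
      (Finset.mem_univ i)
  have h2 := (le_abs_self _).trans (Complex.abs_im_le_norm (resol A z i i))
  rw [le_div_iff₀ hz]
  by_contra hc
  push Not at hc
  have h0 : 0 ≤ ‖resol A z i i‖ := norm_nonneg _
  have hp : 0 < ‖resol A z i i‖ := by
    rcases h0.eq_or_lt with h | h
    · rw [← h] at hc; simp at hc; linarith
    · exact h
  nlinarith [mul_le_mul_of_nonneg_left h1 hz.le]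

theorem resol_double {A : Matrix ι ι ℂ} (hA : A.IsHermitian) {z w : ℂ} {η : ℝ} (hη : 0 < η)
    (hz : z.im = η) (hw : w.im = 2 * η) (hre : z.re = w.re) (i : ι) :
    ‖resol A z i i‖ ≤ 2 * ‖resol A w i i‖ := by
  have hz0 : z.im ≠ 0 := by rw [hz]; exact hη.ne'
  have hw0 : w.im ≠ 0 := by rw [hw]; positivity
  have h := congrFun (congrFun (resol_identity hA hz0 hw0) i) i
  simp only [Matrix.sub_apply, Matrix.smul_apply, Matrix.mul_apply, smul_eq_mul] at h
  have hzw : ‖z - w‖ = η := by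
    have : z - w = ((-η : ℝ) : ℂ) * Complex.I := by
      apply Complex.ext <;> simp [hz, hw, hre]; ring
    rw [this]; simp [abs_of_pos hη]
  have h1 := norm_sum_mul_le (fun j => resol A z i j) (fun j => resol A w j i)
  have hr := resol_ward_row hA hz0 i
  have hc := resol_ward_col hA hw0 i
  have b1 := (le_abs_self _).trans (Complex.abs_im_le_norm (resol A z i i))
  have b2 := (le_abs_self _).trans (Complex.abs_im_le_norm (resol A w i i))
  have hd : ‖resol A z i i‖ - ‖resol A w i i‖
      ≤ η * ‖∑ j, resol A z i j * resol A w j i‖ := by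
    have := norm_sub_norm_le (resol A z i i) (resol A w i i)
    rw [h, norm_mul, hzw] at this
    exact this
  rw [hz] at hr
  rw [hw] at hc
  exact real_aux1 hη (norm_nonneg _) (norm_nonneg _) (norm_nonneg _)
    (Finset.sum_nonneg fun _ _ => by positivity) (Finset.sum_nonneg fun _ _ => by positivity)
    hd h1 (hr.trans_le b1) (hc.trans_le b2)

theorem resol_eigvec {A : Matrix ι ι ℂ} (hA : A.IsHermitian) {z : ℂ} (hz : 0 < z.im) (i : ι)
    {v : ι → ℂ} {μ : ℝ} (hv : ∑ i, ‖v i‖ ^ 2 = 1) (hAv : A.mulVec v = (μ : ℂ) • v) :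
    z.im * ‖v i‖ ^ 2 ≤ ‖(μ : ℂ) - z‖ ^ 2 * ‖resol A z i i‖ := by
  have h1 : v = ((μ : ℂ) - z) • (resol A z).mulVec v := by
    have : (A - z • (1 : Matrix ι ι ℂ)).mulVec v = ((μ : ℂ) - z) • v := by
      rw [Matrix.sub_mulVec, hAv, Matrix.smul_mulVec, Matrix.one_mulVec, sub_smul]
    rw [← Matrix.mulVec_smul, ← this, Matrix.mulVec_mulVec, resol_left hA hz.ne',
      Matrix.one_mulVec]
  have h2 := congrFun h1 i
  simp only [Pi.smul_apply, smul_eq_mul, Matrix.mulVec, dotProduct] at h2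
  have h3 := norm_sum_mul_le (fun j => resol A z i j) v
  rw [hv, mul_one] at h3
  have hr := resol_ward_row hA hz.ne' i
  have b1 := (le_abs_self _).trans (Complex.abs_im_le_norm (resol A z i i))
  rw [h2, norm_mul, mul_pow]
  calc z.im * (‖(μ : ℂ) - z‖ ^ 2 * ‖∑ j, resol A z i j * v j‖ ^ 2)
      ≤ z.im * (‖(μ : ℂ) - z‖ ^ 2 * ∑ j, ‖resol A z i j‖ ^ 2) := by gcongr
    _ = ‖(μ : ℂ) - z‖ ^ 2 * (z.im * ∑ j, ‖resol A z i j‖ ^ 2) := by ring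
    _ ≤ _ := by rw [hr]; gcongr

/-- the minor -/
def minr (A : Matrix ι ι ℂ) (i : ι) : Matrix {k // k ≠ i} {k // k ≠ i} ℂ :=
  A.submatrix Subtype.val Subtype.val

theorem minr_herm {A : Matrix ι ι ℂ} (hA : A.IsHermitian) (i : ι) : (minr A i).IsHermitian :=
  hA.submatrix _

theorem resol_col {A : Matrix ι ι ℂ} (hA : A.IsHermitian) {z : ℂ} (hz : z.im ≠ 0) (i l : ι)
    (j : {k // k ≠ i}) :
    resol A z j l = (if h : l ≠ i then resol (minr A i) z j ⟨l, h⟩ else 0)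
      - resol A z i l * (resol (minr A i) z).mulVec (fun k => A k i) j := by
  have hR := resol_right hA hz
  have h1 : (minr A i - z • (1 : Matrix {k // k ≠ i} {k // k ≠ i} ℂ)).mulVec
      (fun k : {k // k ≠ i} => resol A z k l) =
      fun k : {k // k ≠ i} => (if (k : ι) = l then 1 else 0) - resol A z i l * A k i := by
    funext k
    have h2 := congrFun (congrFun hR k) l
    rw [Matrix.mul_apply, Fintype.sum_eq_add_sum_subtype_ne _ i, Matrix.one_apply] at h2
    simp only [Matrix.sub_apply, Matrix.smul_apply, Matrix.one_apply_ne k.2, smul_zero,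
      sub_zero] at h2
    simp only [Matrix.mulVec, dotProduct, Matrix.sub_apply, Matrix.smul_apply]
    rw [← h2]
    have : ∀ x : {k // k ≠ i}, (1 : Matrix {k // k ≠ i} {k // k ≠ i} ℂ) k x
        = (1 : Matrix ι ι ℂ) k x := by
      intro x; simp [Matrix.one_apply, Subtype.ext_iff]
    simp only [this, minr, Matrix.submatrix_apply]
    ring
  have h3 := congrArg (fun u => (resol (minr A i) z).mulVec u) h1
  simp only [Matrix.mulVec_mulVec, resol_left (minr_herm hA i) hz, Matrix.one_mulVec] at h3
  have h4 := congrFun h3 j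
  rw [h4]
  simp only [Matrix.mulVec, dotProduct, mul_sub, Finset.sum_sub_distrib]
  congr 1
  · split_ifs with h
    · simp only [mul_ite, mul_one, mul_zero]
      rw [Finset.sum_eq_single (⟨l, h⟩ : {k // k ≠ i})]
      · simp
      · intro b _ hb
        rw [if_neg]; intro hh; apply hb; exact Subtype.ext hh
      · simp
    · push Not at h
      apply Finset.sum_eq_zero
      intro x _
      rw [if_neg (by rw [h]; exact x.2)]; simp
  · rw [Finset.mul_sum]; apply Finset.sum_congr rfl; intros; ring

/-- the quadratic form -/
def qform (A : Matrix ι ι ℂ) (z : ℂ) (i : ι) : ℂ :=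
  ∑ k : {k // k ≠ i}, ∑ l : {k // k ≠ i},
    star (A k i) * resol (minr A i) z k l * A l i

theorem resol_schur {A : Matrix ι ι ℂ} (hA : A.IsHermitian) {z : ℂ} (hz : z.im ≠ 0) (i : ι) :
    resol A z i i * (A i i - z - qform A z i) = 1 := by
  have h2 := congrFun (congrFun (resol_right hA hz) i) i
  rw [Matrix.mul_apply, Fintype.sum_eq_add_sum_subtype_ne _ i, Matrix.one_apply_eq] at h2
  simp only [resol_col hA hz i i] at h2
  simp only [ne_eq, not_true_eq_false, dite_false, zero_sub, Matrix.sub_apply, Matrix.smul_apply,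
    Matrix.one_apply_eq, smul_eq_mul, mul_one] at h2
  rw [← h2, qform, mul_sub, mul_comm, sub_eq_add_neg]
  congr 1
  rw [Finset.mul_sum, ← Finset.sum_neg_distrib]
  apply Finset.sum_congr rfl
  intro k _
  rw [Matrix.one_apply_ne (Ne.symm k.2), mul_zero, sub_zero, hA.apply]
  simp only [Matrix.mulVec, dotProduct, Finset.mul_sum, mul_neg, neg_inj]
  apply Finset.sum_congr rfl
  intros; ring

theorem resol_trace_diff {A : Matrix ι ι ℂ} (hA : A.IsHermitian) {z : ℂ} (hz : 0 < z.im) (i : ι) :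
    ‖∑ k, resol A z k k - ∑ k, resol (minr A i) z k k‖ ≤ 1 / z.im := by
  have hne : resol A z i i ≠ 0 := by
    intro h; have := resol_schur hA hz.ne' i; rw [h] at this; simp at this
  have e1 : ∀ j : {k // k ≠ i}, resol A z j i
      = - (resol A z i i * (resol (minr A i) z).mulVec (fun k => A k i) j) := by
    intro j
    have := resol_col hA hz.ne' i i j
    simpa using this
  have e2 : ∀ j : {k // k ≠ i}, resol A z j j - resol (minr A i) z j j
      = - (resol A z i j * (resol (minr A i) z).mulVec (fun k => A k i) j) := by
    intro j
    have := resol_col hA hz.ne' i j j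
    rw [dif_pos j.2] at this
    rw [this]; simp
  have e3 : resol A z i i * (∑ k, resol A z k k - ∑ k, resol (minr A i) z k k)
      = ∑ j, resol A z i j * resol A z j i := by
    rw [Fintype.sum_eq_add_sum_subtype_ne (fun k => resol A z k k) i,
      Fintype.sum_eq_add_sum_subtype_ne _ i, add_sub_assoc, ← Finset.sum_sub_distrib, mul_add,
      Finset.mul_sum]
    congr 1
    apply Finset.sum_congr rfl
    intro j _
    rw [e2, e1]; ring
  have h1 := norm_sum_mul_le (fun j => resol A z i j) (fun j => resol A z j i)
  rw [← e3, norm_mul] at h1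
  have hr := resol_ward_row hA hz.ne' i
  have hc := resol_ward_col hA hz.ne' i
  have b1 := (le_abs_self _).trans (Complex.abs_im_le_norm (resol A z i i))
  exact real_aux2 hz (norm_pos_iff.mpr hne)
    (Finset.sum_nonneg fun _ _ => by positivity) (Finset.sum_nonneg fun _ _ => by positivity)
    h1 (hr.trans_le b1) (hc.trans_le b1)

end DetPart

section Boot

open scoped Classical in
/-- weighted count of bad scales -/
def Rr (b : ℕ → Prop) : ℕ → ℝ
  | 0 => 0
  | j + 1 => 2 * Rr b j + (if b (j + 1) then 1 else 0)

theorem Rr_nonneg (b : ℕ → Prop) (j : ℕ) : 0 ≤ Rr b j := by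
  induction j with
  | zero => simp [Rr]
  | succ j ih => rw [Rr]; split_ifs <;> linarith

theorem Rr_mono (b : ℕ → Prop) : Monotone (Rr b) := by
  apply monotone_nat_of_le_succ
  intro j
  have := Rr_nonneg b j
  rw [Rr]; split_ifs <;> linarith

theorem boot {ι : Type*} [Fintype ι] [Nonempty ι] (g : ℕ → ι → ℂ) (z : ℕ → ℂ) (J : ℕ)
    (B : ℕ → ι → Prop)
    (hz : ∀ j, ‖z j‖ ≤ 3) (h0 : ∀ i, ‖g 0 i‖ ≤ 1)
    (hdbl : ∀ j i, ‖g (j + 1) i‖ ≤ 2 * ‖g j i‖)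
    (hself : ∀ j < J, ∀ i, ¬ B (j + 1) i → ∑ k, ‖g (j + 1) k‖ ≤ 40 * Fintype.card ι →
      ∃ Z : ℂ, ‖Z‖ ≤ 1 / 6400 ∧
        g (j + 1) i * (z (j + 1) + (∑ k, g (j + 1) k) / Fintype.card ι + Z) = -1)
    (hR : ∑ i, Rr (fun j => B j i) J ≤ Fintype.card ι / 120) :
    ∀ j ≤ J, (∀ i, ‖g j i‖ ≤ 10 * (1 + Rr (fun j => B j i) j)) ∧
      (1 ≤ j → ∀ i, ¬ B j i → ‖g j i‖ ≤ 10) := by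
  have hN : (0 : ℝ) < Fintype.card ι := by exact_mod_cast Fintype.card_pos
  intro j
  induction j with
  | zero =>
    intro _
    refine ⟨fun i => ?_, by simp⟩
    simp only [Rr]; linarith [h0 i]
  | succ j ih =>
    intro hj
    obtain ⟨ih1, -⟩ := ih (by omega)
    have hRs : ∀ j ≤ J, ∑ i, Rr (fun j => B j i) j ≤ Fintype.card ι / 120 := fun j hj =>
      (Finset.sum_le_sum fun i _ => Rr_mono _ hj).trans hR
    have hsum : ∑ k, ‖g (j + 1) k‖ ≤ 40 * Fintype.card ι := by
      calc ∑ k, ‖g (j + 1) k‖ ≤ ∑ k, (20 + 20 * Rr (fun j => B j k) j) := by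
            apply Finset.sum_le_sum; intro i _
            have := hdbl j i; have := ih1 i; linarith
        _ = 20 * Fintype.card ι + 20 * ∑ k, Rr (fun j => B j k) j := by
            rw [Finset.sum_add_distrib, ← Finset.mul_sum]; simp; ring
        _ ≤ _ := by have := hRs j (by omega); linarith
    have hs := hself j (by omega)
    set m := (∑ k, g (j + 1) k) / (Fintype.card ι : ℂ) with hm
    set w := z (j + 1) + m with hw
    -- find a good index
    obtain ⟨i0, hi0⟩ : ∃ i, Rr (fun j => B j i) (j + 1) < 1 := by
      by_contra hcon
      push Not at hcon
      have : (Fintype.card ι : ℝ) ≤ ∑ i, Rr (fun j => B j i) (j + 1) := by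
        calc (Fintype.card ι : ℝ) = ∑ i : ι, (1 : ℝ) := by simp
          _ ≤ _ := Finset.sum_le_sum fun i _ => hcon i
      have := hRs (j + 1) hj
      linarith
    have hnb : ¬ B (j + 1) i0 := by
      intro hb
      rw [Rr, if_pos hb] at hi0
      have := Rr_nonneg (fun j => B j i0) j
      linarith
    have hw40 : 1 / 40 ≤ ‖w‖ := by
      obtain ⟨Z, hZ, hg⟩ := hs i0 hnb hsum
      have h1 : ‖g (j + 1) i0‖ ≤ 30 := by
        have h2 := hdbl j i0
        have h3 := ih1 i0
        rw [Rr, if_neg hnb] at hi0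
        linarith
      have h2 := congrArg norm hg
      rw [norm_mul, norm_neg, norm_one] at h2
      have h3 : ‖w + Z‖ ≤ ‖w‖ + ‖Z‖ := norm_add_le _ _
      have h4 := norm_nonneg (w + Z)
      nlinarith
    have hw0 : w ≠ 0 := by
      intro h; rw [h, norm_zero] at hw40; norm_num at hw40
    have hwi : ‖1 / w‖ ≤ 40 := by
      rw [norm_div, norm_one, div_le_iff₀ (by linarith)]; linarith
    have hgood : ∀ i, ¬ B (j + 1) i → ‖g (j + 1) i + 1 / w‖ ≤ 1 / 2 := by
      intro i hi
      obtain ⟨Z, hZ, hg⟩ := hs i hi hsum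
      have h2 := congrArg norm hg
      rw [norm_mul, norm_neg, norm_one] at h2
      have h3 : ‖w‖ ≤ ‖w + Z‖ + ‖Z‖ := by
        have := norm_sub_le (w + Z) Z; simpa using this
      have h5 : ‖g (j + 1) i‖ ≤ 80 := by
        have := norm_nonneg (g (j + 1) i)
        nlinarith
      have h6 : g (j + 1) i + 1 / w = - (g (j + 1) i * Z * (1 / w)) := by
        field_simp
        linear_combination hg
      rw [h6, norm_neg, norm_mul, norm_mul]
      calc ‖g (j + 1) i‖ * ‖Z‖ * ‖1 / w‖ ≤ 80 * (1 / 6400) * 40 := by gcongr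
        _ = 1 / 2 := by norm_num
    have hbadb : ∀ i, B (j + 1) i → ‖g (j + 1) i‖ ≤ 10 * (1 + Rr (fun j => B j i) (j + 1)) := by
      intro i hi
      rw [Rr, if_pos hi]
      have := hdbl j i; have := ih1 i; linarith
    have hall : ∀ i, ‖g (j + 1) i + 1 / w‖ ≤ 1 / 2 + 60 * Rr (fun j => B j i) (j + 1) := by
      intro i
      by_cases hi : B (j + 1) i
      · have h1 := hbadb i hi
        have h2 := norm_add_le (g (j + 1) i) (1 / w)
        have h3 : 1 ≤ Rr (fun j => B j i) (j + 1) := by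
          rw [Rr, if_pos hi]
          have := Rr_nonneg (fun j => B j i) j
          linarith
        linarith
      · have := hgood i hi
        have := Rr_nonneg (fun j => B j i) (j + 1)
        linarith
    have hmw : ‖m + 1 / w‖ ≤ 1 := by
      have e : m + 1 / w = (∑ k, (g (j + 1) k + 1 / w)) / (Fintype.card ι : ℂ) := by
        have : (Fintype.card ι : ℂ) ≠ 0 := by exact_mod_cast hN.ne'
        rw [Finset.sum_add_distrib, hm]
        simp only [Finset.sum_const, Finset.card_univ, nsmul_eq_mul]
        field_simp
      rw [e, norm_div, Complex.norm_natCast, div_le_one hN]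
      calc ‖∑ k, (g (j + 1) k + 1 / w)‖ ≤ ∑ k, ‖g (j + 1) k + 1 / w‖ := norm_sum_le _ _
        _ ≤ ∑ k, (1 / 2 + 60 * Rr (fun j => B j k) (j + 1)) :=
            Finset.sum_le_sum fun i _ => hall i
        _ = 1 / 2 * Fintype.card ι + 60 * ∑ k, Rr (fun j => B j k) (j + 1) := by
            rw [Finset.sum_add_distrib, ← Finset.mul_sum]; simp; ring
        _ ≤ _ := by have := hRs (j + 1) hj; linarith
    have hw5 : 1 / 5 ≤ ‖w‖ := by
      by_contra hc
      push Not at hc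
      have h1 : ‖1 / w‖ ≤ ‖w‖ + 4 := by
        have e : 1 / w = (m + 1 / w) - w + z (j + 1) := by rw [hw]; ring
        calc ‖1 / w‖ = ‖(m + 1 / w) - w + z (j + 1)‖ := by rw [← e]
          _ ≤ ‖m + 1 / w‖ + ‖w‖ + ‖z (j + 1)‖ :=
            (norm_add_le _ _).trans (by gcongr; exact norm_sub_le _ _)
          _ ≤ _ := by linarith [hz (j + 1)]
      rw [norm_div, norm_one, div_le_iff₀ (by linarith)] at h1
      nlinarith
    have hg10 : ∀ i, ¬ B (j + 1) i → ‖g (j + 1) i‖ ≤ 10 := by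
      intro i hi
      obtain ⟨Z, hZ, hg⟩ := hs i hi hsum
      have h2 := congrArg norm hg
      rw [norm_mul, norm_neg, norm_one] at h2
      have h3 : ‖w‖ ≤ ‖w + Z‖ + ‖Z‖ := by
        have := norm_sub_le (w + Z) Z; simpa using this
      have := norm_nonneg (g (j + 1) i)
      nlinarith
    refine ⟨fun i => ?_, fun _ => hg10⟩
    by_cases hi : B (j + 1) i
    · exact hbadb i hi
    · have := hg10 i hi
      have := Rr_nonneg (fun j => B j i) (j + 1)
      linarith

variable {ι : Type*} [Fintype ι] [DecidableEq ι]

/-- spectral parameter at scale `2⁻ʲ` -/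
def zz (E : ℝ) (j : ℕ) : ℂ := ⟨E, (1 / 2) ^ j⟩

/-- bad event for the index `i` at scale `2⁻ʲ`: quadratic form part -/
def BadQ (A : Matrix ι ι ℂ) (E : ℝ) (j : ℕ) (i : ι) : Prop :=
    ‖(∑ k, resol (minr A i) (zz E j) k k) / (Fintype.card ι : ℂ)‖ ≤ 41 ∧
    1 / 19200 < ‖qform A (zz E j) i
      - (∑ k, resol (minr A i) (zz E j) k k) / (Fintype.card ι : ℂ)‖

/-- bad event -/
def Bad (A : Matrix ι ι ℂ) (E : ℝ) (j : ℕ) (i : ι) : Prop :=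
  1 / 19200 < ‖A i i‖ ∨ BadQ A E j i

theorem det_main [Nonempty ι] {A : Matrix ι ι ℂ} (hA : A.IsHermitian) {E : ℝ} (hE : |E| ≤ 2)
    {J : ℕ} (hJ : 1 ≤ J) (hL : 19200 ≤ Fintype.card ι * (1 / 2 : ℝ) ^ J)
    (hR : ∑ i, Rr (fun j => Bad A E j i) J ≤ Fintype.card ι / 120) (i : ι)
    (hi : ¬ Bad A E J i) : ‖resol A (zz E J) i i‖ ≤ 10 := by
  have him : ∀ j, 0 < (zz E j).im := fun j => by simp [zz]
  have hN : (0 : ℝ) < Fintype.card ι := by exact_mod_cast Fintype.card_pos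
  have hNC : (Fintype.card ι : ℂ) ≠ 0 := by exact_mod_cast hN.ne'
  refine (boot (fun j i => resol A (zz E j) i i) (zz E) J (fun j i => Bad A E j i)
    ?_ ?_ ?_ ?_ hR J le_rfl).2 hJ i hi
  · intro j
    refine (Complex.norm_le_abs_re_add_abs_im _).trans ?_
    have : (1 / 2 : ℝ) ^ j ≤ 1 := pow_le_one₀ (by norm_num) (by norm_num)
    have h2 : |(zz E j).im| ≤ 1 := by rw [abs_of_pos (him j)]; exact this
    have h3 : |(zz E j).re| ≤ 2 := hE
    linarith
  · intro i
    refine (resol_diag_le hA (him 0) i).trans ?_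
    simp [zz]
  · intro j i
    refine resol_double (w := zz E j) hA (him (j + 1)) rfl ?_ rfl i
    simp only [zz, pow_succ]; ring
  · intro j hj i hb hsum
    set T := ∑ k, resol (minr A i) (zz E (j + 1)) k k with hT
    set S := ∑ k, resol A (zz E (j + 1)) k k with hS
    have hd : ‖S / (Fintype.card ι : ℂ) - T / (Fintype.card ι : ℂ)‖ ≤ 1 / 19200 := by
      rw [← sub_div, norm_div, Complex.norm_natCast, div_le_iff₀ hN]
      refine (resol_trace_diff hA (him (j + 1)) i).trans ?_
      rw [div_le_iff₀ (him _)]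
      have h1 : (1 / 2 : ℝ) ^ J ≤ (1 / 2) ^ (j + 1) :=
        pow_le_pow_of_le_one (by norm_num) (by norm_num) (by omega)
      have h2 : (zz E (j + 1)).im = (1 / 2) ^ (j + 1) := rfl
      rw [h2]
      have := mul_le_mul_of_nonneg_left h1 hN.le
      linarith
    have hSn : ‖S / (Fintype.card ι : ℂ)‖ ≤ 40 := by
      rw [norm_div, Complex.norm_natCast, div_le_iff₀ hN]
      exact (norm_sum_le _ _).trans hsum
    have hTn : ‖T / (Fintype.card ι : ℂ)‖ ≤ 41 := by
      have := norm_sub_norm_le (T / (Fintype.card ι : ℂ)) (S / (Fintype.card ι : ℂ))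
      rw [norm_sub_rev] at this
      linarith
    unfold Bad BadQ at hb
    push Not at hb
    obtain ⟨hb1, hb2⟩ := hb
    have hb3 := hb2 hTn
    refine ⟨- A i i + (qform A (zz E (j + 1)) i - T / (Fintype.card ι : ℂ))
      - (S / (Fintype.card ι : ℂ) - T / (Fintype.card ι : ℂ)), ?_, ?_⟩
    · refine (norm_sub_le _ _).trans ?_
      have := norm_add_le (- A i i) (qform A (zz E (j + 1)) i - T / (Fintype.card ι : ℂ))
      rw [norm_neg] at this
      linarith
    · have := resol_schur hA (him (j + 1)).ne' i
      linear_combination -this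

end Boot

section QF

/-- admissible laws -/
structure GoodLaw (δ D : ℝ) (μ : Measure ℂ) : Prop where
  prob : IsProbabilityMeasure μ
  mean : ∫ z, z ∂μ = 0
  var : ∫ z, ‖z‖ ^ 2 ∂μ = 1
  expm : ∫⁻ z, ENNReal.ofReal (Real.exp (δ * ‖z‖ ^ 2)) ∂μ ≤ ENNReal.ofReal D

theorem exp_le_quad (x : ℝ) : Real.exp x ≤ 1 + x + x ^ 2 * Real.exp |x| := by
  have h1 : 1 ≤ Real.exp |x| := Real.one_le_exp (abs_nonneg x)
  by_cases hx : |x| ≤ 1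
  · have := Real.abs_exp_sub_one_sub_id_le hx
    have := (abs_le.mp this).2
    nlinarith [sq_nonneg x]
  · push Not at hx
    rcases le_or_gt 0 x with h | h
    · rw [abs_of_nonneg h] at *
      have h2 : 1 ≤ x ^ 2 := by nlinarith
      nlinarith [mul_le_mul_of_nonneg_right h2 (Real.exp_pos x).le]
    · rw [abs_of_neg h] at *
      have : Real.exp x ≤ 1 := Real.exp_le_one_iff.mpr h.le
      nlinarith

variable {δ D : ℝ} {μ : Measure ℂ}

theorem GoodLaw.D_nonneg (h : GoodLaw δ D μ) (hδ : 0 < δ) : 0 ≤ D := by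
  have := h.prob
  by_contra hc
  push Not at hc
  have h1 := h.expm
  rw [ENNReal.ofReal_of_nonpos hc.le] at h1
  have h2 : (1 : ℝ≥0∞) ≤ ∫⁻ z, ENNReal.ofReal (Real.exp (δ * ‖z‖ ^ 2)) ∂μ := by
    calc (1 : ℝ≥0∞) = ∫⁻ z, 1 ∂μ := by simp
      _ ≤ _ := by
        apply lintegral_mono
        intro z
        change (1 : ℝ≥0∞) ≤ _
        rw [← ENNReal.ofReal_one]
        apply ENNReal.ofReal_le_ofReal
        apply Real.one_le_exp; positivity
  have := h2.trans h1
  simp at this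

theorem GoodLaw.intExp (h : GoodLaw δ D μ) : Integrable (fun z => Real.exp (δ * ‖z‖ ^ 2)) μ := by
  refine ⟨by fun_prop, ?_⟩
  rw [hasFiniteIntegral_iff_ofReal (Filter.Eventually.of_forall fun z => (Real.exp_pos _).le)]
  exact h.expm.trans_lt ENNReal.ofReal_lt_top

theorem GoodLaw.intExp_le (h : GoodLaw δ D μ) (hδ : 0 < δ) :
    ∫ z, Real.exp (δ * ‖z‖ ^ 2) ∂μ ≤ D := by
  rw [integral_eq_lintegral_of_nonneg_ae (Filter.Eventually.of_forall fun z => (Real.exp_pos _).le)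
    (by fun_prop)]
  exact ENNReal.toReal_le_of_le_ofReal (h.D_nonneg hδ) h.expm

theorem GoodLaw.intSq (h : GoodLaw δ D μ) : Integrable (fun z : ℂ => ‖z‖ ^ 2) μ := by
  apply Integrable.of_integral_ne_zero
  rw [h.var]; norm_num

theorem GoodLaw.intId (h : GoodLaw δ D μ) : Integrable (fun z : ℂ => z) μ := by
  have := h.prob
  refine Integrable.mono' (g := fun z => 1 + ‖z‖ ^ 2) ((integrable_const 1).add h.intSq)
    (by fun_prop) (Filter.Eventually.of_forall fun z => ?_)
  nlinarith [sq_nonneg (‖z‖ - 1)]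

theorem GoodLaw.mgf_gen (h : GoodLaw δ D μ) (hδ : 0 < δ) {f : ℂ → ℝ} (hf : Integrable f μ)
    (hf0 : ∫ z, f z ∂μ = 0) {k : ℝ} (hk : 0 ≤ k)
    (hb : ∀ z, Real.exp (f z) ≤ 1 + f z + k * Real.exp (δ * ‖z‖ ^ 2)) :
    ∫⁻ z, ENNReal.ofReal (Real.exp (f z)) ∂μ ≤ ENNReal.ofReal (Real.exp (k * D)) := by
  have := h.prob
  have hi : Integrable (fun z => 1 + f z + k * Real.exp (δ * ‖z‖ ^ 2)) μ :=
    ((integrable_const 1).add hf).add (h.intExp.const_mul k)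
  calc ∫⁻ z, ENNReal.ofReal (Real.exp (f z)) ∂μ
      ≤ ∫⁻ z, ENNReal.ofReal (1 + f z + k * Real.exp (δ * ‖z‖ ^ 2)) ∂μ :=
        lintegral_mono fun z => ENNReal.ofReal_le_ofReal (hb z)
    _ = ENNReal.ofReal (∫ z, 1 + f z + k * Real.exp (δ * ‖z‖ ^ 2) ∂μ) := by
        rw [ofReal_integral_eq_lintegral_ofReal hi]
        exact Filter.Eventually.of_forall fun z => (Real.exp_pos _).le.trans (hb z)
    _ ≤ _ := by
        apply ENNReal.ofReal_le_ofReal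
        have e : ∫ z, 1 + f z + k * Real.exp (δ * ‖z‖ ^ 2) ∂μ
            = 1 + 0 + k * ∫ z, Real.exp (δ * ‖z‖ ^ 2) ∂μ := by
          have i1 : Integrable (fun z => 1 + f z) μ := (integrable_const 1).add hf
          rw [integral_add i1 (h.intExp.const_mul k),
            integral_add (integrable_const 1) hf, hf0, integral_const_mul]
          simp
        rw [e]
        have h1 := mul_le_mul_of_nonneg_left (h.intExp_le hδ) hk
        have h2 := Real.add_one_le_exp (k * D)
        linarith

/-- Laplace transform of a linear functional -/
theorem GoodLaw.mgf_lin (hδ : 0 < δ) : ∃ C1 : ℝ, 0 < C1 ∧ ∀ μ, GoodLaw δ D μ → ∀ b : ℂ,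
    ∫⁻ z, ENNReal.ofReal (Real.exp (b * z).re) ∂μ
      ≤ ENNReal.ofReal (Real.exp (C1 * ‖b‖ ^ 2)) := by
  set K := 2 / δ * Real.exp (1 / (2 * δ)) with hK
  have hKpos : 0 < K := by positivity
  refine ⟨K * |D| + |D| + 1 / (4 * δ), by positivity, fun μ h b => ?_⟩
  have := h.prob
  have hD := h.D_nonneg hδ
  rw [abs_of_nonneg hD]
  have habs : ∀ z : ℂ, |(b * z).re| ≤ ‖b‖ * ‖z‖ := fun z => by
    rw [← norm_mul]; exact Complex.abs_re_le_norm _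
  rcases le_or_gt ‖b‖ 1 with hb | hb
  · refine (h.mgf_gen hδ (f := fun z => (b * z).re) (k := K * ‖b‖ ^ 2) ?_ ?_ (by positivity)
      ?_).trans ?_
    · exact (h.intId.const_mul b).re
    · have h1 := integral_re (h.intId.const_mul b)
      have h2 : ∫ z, b * z ∂μ = 0 := by rw [integral_const_mul, h.mean, mul_zero]
      rw [h2] at h1
      simpa using h1
    · intro z
      refine (exp_le_quad _).trans (add_le_add_right ?_ _)
      have h1 : (b * z).re ^ 2 ≤ ‖b‖ ^ 2 * ‖z‖ ^ 2 := by
        rw [← mul_pow, ← sq_abs]; gcongr; exact habs z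
      have h2 : |(b * z).re| ≤ 1 / (2 * δ) + δ * ‖z‖ ^ 2 / 2 := by
        have h3 : ‖b‖ * ‖z‖ ≤ ‖z‖ := by nlinarith [norm_nonneg z]
        have h4 : ‖z‖ ≤ 1 / (2 * δ) + δ * ‖z‖ ^ 2 / 2 := by
          have : 1 / (2 * δ) + δ * ‖z‖ ^ 2 / 2 - ‖z‖ = (δ * ‖z‖ - 1) ^ 2 / (2 * δ) := by
            field_simp; ring
          have h5 : 0 ≤ (δ * ‖z‖ - 1) ^ 2 / (2 * δ) := by positivity
          linarith
        linarith [habs z]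
      have h3 : ‖z‖ ^ 2 ≤ 2 / δ * Real.exp (δ * ‖z‖ ^ 2 / 2) := by
        have := Real.add_one_le_exp (δ * ‖z‖ ^ 2 / 2)
        rw [div_mul_eq_mul_div, le_div_iff₀ hδ]
        linarith
      calc (b * z).re ^ 2 * Real.exp |(b * z).re|
          ≤ (‖b‖ ^ 2 * (2 / δ * Real.exp (δ * ‖z‖ ^ 2 / 2)))
            * Real.exp (1 / (2 * δ) + δ * ‖z‖ ^ 2 / 2) := by
            gcongr
            exact h1.trans (by gcongr)
        _ = K * ‖b‖ ^ 2 * (Real.exp (δ * ‖z‖ ^ 2 / 2) * Real.exp (δ * ‖z‖ ^ 2 / 2)) := by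
            rw [Real.exp_add, hK]; ring
        _ = _ := by rw [← Real.exp_add]; ring_nf
    · apply ENNReal.ofReal_le_ofReal
      apply Real.exp_le_exp.mpr
      have : 0 ≤ (D + 1 / (4 * δ)) * ‖b‖ ^ 2 := by positivity
      nlinarith
  · calc ∫⁻ z, ENNReal.ofReal (Real.exp (b * z).re) ∂μ
        ≤ ∫⁻ z, ENNReal.ofReal (Real.exp (‖b‖ ^ 2 / (4 * δ)))
            * ENNReal.ofReal (Real.exp (δ * ‖z‖ ^ 2)) ∂μ := by
          apply lintegral_mono
          intro z
          beta_reduce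
          rw [← ENNReal.ofReal_mul (Real.exp_pos _).le, ← Real.exp_add]
          apply ENNReal.ofReal_le_ofReal
          apply Real.exp_le_exp.mpr
          have h1 := (le_abs_self _).trans (habs z)
          have : ‖b‖ ^ 2 / (4 * δ) + δ * ‖z‖ ^ 2 - ‖b‖ * ‖z‖
              = (2 * δ * ‖z‖ - ‖b‖) ^ 2 / (4 * δ) := by
            field_simp; ring
          have h5 : 0 ≤ (2 * δ * ‖z‖ - ‖b‖) ^ 2 / (4 * δ) := by positivity
          linarith
      _ = ENNReal.ofReal (Real.exp (‖b‖ ^ 2 / (4 * δ)))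
            * ∫⁻ z, ENNReal.ofReal (Real.exp (δ * ‖z‖ ^ 2)) ∂μ := by
          rw [lintegral_const_mul]; fun_prop
      _ ≤ ENNReal.ofReal (Real.exp (‖b‖ ^ 2 / (4 * δ))) * ENNReal.ofReal D := by
          gcongr; exact h.expm
      _ ≤ _ := by
          rw [← ENNReal.ofReal_mul (Real.exp_pos _).le]
          apply ENNReal.ofReal_le_ofReal
          have h1 : D ≤ Real.exp (D * ‖b‖ ^ 2) := by
            have := Real.add_one_le_exp (D * ‖b‖ ^ 2)
            have h2 : 1 ≤ ‖b‖ ^ 2 := by nlinarith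
            nlinarith
          calc Real.exp (‖b‖ ^ 2 / (4 * δ)) * D
              ≤ Real.exp (‖b‖ ^ 2 / (4 * δ)) * Real.exp (D * ‖b‖ ^ 2) := by gcongr
            _ = Real.exp (‖b‖ ^ 2 / (4 * δ) + D * ‖b‖ ^ 2) := by rw [Real.exp_add]
            _ ≤ _ := by
              apply Real.exp_le_exp.mpr
              have : 0 ≤ K * D * ‖b‖ ^ 2 := by positivity
              have e : (K * D + D + 1 / (4 * δ)) * ‖b‖ ^ 2
                = K * D * ‖b‖ ^ 2 + (‖b‖ ^ 2 / (4 * δ) + D * ‖b‖ ^ 2) := by ring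
              linarith

theorem GoodLaw.mgf_sq (hδ : 0 < δ) : ∃ C5 : ℝ, 0 < C5 ∧ ∀ μ, GoodLaw δ D μ → ∀ t : ℝ,
    |t| ≤ δ / 2 → ∫⁻ z, ENNReal.ofReal (Real.exp (t * (‖z‖ ^ 2 - 1))) ∂μ
      ≤ ENNReal.ofReal (Real.exp (C5 * t ^ 2)) := by
  refine ⟨8 / δ ^ 2 * Real.exp δ * |D| + 1, by positivity, fun μ h t ht => ?_⟩
  have := h.prob
  have hD := h.D_nonneg hδ
  rw [abs_of_nonneg hD]
  refine (h.mgf_gen hδ (f := fun z => t * (‖z‖ ^ 2 - 1)) (k := 8 / δ ^ 2 * Real.exp δ * t ^ 2)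
      ?_ ?_ (by positivity) ?_).trans ?_
  · exact (h.intSq.sub (integrable_const 1)).const_mul t
  · rw [integral_const_mul, integral_sub h.intSq (integrable_const 1), h.var]; simp
  · intro z
    refine (exp_le_quad _).trans (add_le_add_right ?_ _)
    have h0 : |‖z‖ ^ 2 - 1| ≤ ‖z‖ ^ 2 + 1 := by
      rw [abs_le]; constructor <;> nlinarith [sq_nonneg ‖z‖]
    have h1 : |t * (‖z‖ ^ 2 - 1)| ≤ δ / 2 * (‖z‖ ^ 2 + 1) := by
      rw [abs_mul]; gcongr
    have h2 : (‖z‖ ^ 2 - 1) ^ 2 ≤ 8 / δ ^ 2 * Real.exp (δ / 2 * (‖z‖ ^ 2 + 1)) := by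
      have := Real.quadratic_le_exp_of_nonneg (x := δ / 2 * (‖z‖ ^ 2 + 1)) (by positivity)
      have h3 : (‖z‖ ^ 2 - 1) ^ 2 ≤ (‖z‖ ^ 2 + 1) ^ 2 := by nlinarith [sq_nonneg ‖z‖]
      rw [div_mul_eq_mul_div, le_div_iff₀ (by positivity)]
      have h4 : 0 ≤ δ / 2 * (‖z‖ ^ 2 + 1) := by positivity
      nlinarith [sq_nonneg δ]
    calc (t * (‖z‖ ^ 2 - 1)) ^ 2 * Real.exp |t * (‖z‖ ^ 2 - 1)|
        ≤ (t ^ 2 * (8 / δ ^ 2 * Real.exp (δ / 2 * (‖z‖ ^ 2 + 1))))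
          * Real.exp (δ / 2 * (‖z‖ ^ 2 + 1)) := by
          rw [mul_pow]; gcongr
      _ = 8 / δ ^ 2 * t ^ 2 * (Real.exp (δ / 2 * (‖z‖ ^ 2 + 1))
            * Real.exp (δ / 2 * (‖z‖ ^ 2 + 1))) := by ring
      _ = 8 / δ ^ 2 * t ^ 2 * (Real.exp δ * Real.exp (δ * ‖z‖ ^ 2)) := by
          rw [← Real.exp_add, ← Real.exp_add]; ring_nf
      _ = _ := by ring
  · apply ENNReal.ofReal_le_ofReal
    apply Real.exp_le_exp.mpr
    nlinarith [sq_nonneg t]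

/-- lintegral of exponential of a sum of functions of independent coordinates -/
theorem lintegral_pi_exp_sum {ι : Type*} [Fintype ι] (μ : ι → Measure ℂ)
    [∀ i, IsProbabilityMeasure (μ i)] (f : ι → ℂ → ℝ) (hf : ∀ i, Measurable (f i)) :
    ∫⁻ x, ENNReal.ofReal (Real.exp (∑ i, f i (x i))) ∂(Measure.pi μ)
      = ∏ i, ∫⁻ z, ENNReal.ofReal (Real.exp (f i z)) ∂(μ i) := by
  have hm : ∀ i, Measurable fun z => ENNReal.ofReal (Real.exp (f i z)) := fun i =>
    ENNReal.measurable_ofReal.comp (Real.measurable_exp.comp (hf i))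
  have h1 := lintegral_prod_eq_prod_lintegral_of_indepFun Finset.univ
    (fun i (x : ι → ℂ) => ENNReal.ofReal (Real.exp (f i (x i))))
    (iIndepFun_pi (μ := μ) (X := fun i z => ENNReal.ofReal (Real.exp (f i z)))
      fun i => (hm i).aemeasurable) (fun i => (hm i).comp (measurable_pi_apply i))
  calc _ = ∫⁻ x, ∏ i, ENNReal.ofReal (Real.exp (f i (x i))) ∂(Measure.pi μ) := by
        apply lintegral_congr; intro x
        rw [Real.exp_sum, ENNReal.ofReal_prod_of_nonneg fun i _ => (Real.exp_pos _).le]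
    _ = _ := h1
    _ = _ := by
        apply Finset.prod_congr rfl
        intro i _
        exact (measurePreserving_eval μ i).lintegral_comp (hm i)

theorem lintegral_pi_exp_le {ι : Type*} [Fintype ι] (μ : ι → Measure ℂ)
    [∀ i, IsProbabilityMeasure (μ i)] (f : ι → ℂ → ℝ) (hf : ∀ i, Measurable (f i)) (b : ι → ℝ)
    (hb : ∀ i, ∫⁻ z, ENNReal.ofReal (Real.exp (f i z)) ∂(μ i) ≤ ENNReal.ofReal (Real.exp (b i))) :
    ∫⁻ x, ENNReal.ofReal (Real.exp (∑ i, f i (x i))) ∂(Measure.pi μ)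
      ≤ ENNReal.ofReal (Real.exp (∑ i, b i)) := by
  rw [lintegral_pi_exp_sum μ f hf, Real.exp_sum,
    ENNReal.ofReal_prod_of_nonneg fun i _ => (Real.exp_pos _).le]
  exact Finset.prod_le_prod' fun i _ => hb i

end QF

section QF2
variable {δ D : ℝ}

theorem exp_sq_le_aux {q x : ℝ} (hq : 0 < q) (hx : 0 ≤ x) :
    ∃ n : ℕ, Real.exp (x ^ 2 / (4 * q)) ≤ Real.exp q * Real.exp (n * x - n ^ 2 * q) := by
  refine ⟨⌊x / (2 * q)⌋₊, ?_⟩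
  rw [← Real.exp_add]
  apply Real.exp_le_exp.mpr
  have h1 := Nat.floor_le (a := x / (2 * q)) (by positivity)
  have h2 := Nat.lt_floor_add_one (x / (2 * q))
  set n : ℝ := ((⌊x / (2 * q)⌋₊ : ℕ) : ℝ)
  have e : x = (x / (2 * q)) * (2 * q) := by field_simp
  set u := x / (2 * q)
  rw [e]
  have : (u * (2 * q)) ^ 2 / (4 * q) = u ^ 2 * q := by field_simp; ring
  rw [this]
  have h3 : (u - n) ^ 2 ≤ 1 := by nlinarith
  nlinarith

theorem exp_norm_le (n : ℝ) (W : ℂ) (hn : 0 ≤ n) : Real.exp (n * ‖W‖) ≤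
    Real.exp (2 * n * W).re + Real.exp (-(2 * n) * W).re
      + Real.exp (2 * n * Complex.I * W).re + Real.exp (-(2 * n * Complex.I) * W).re := by
  have e1 : (2 * n * W).re = 2 * n * W.re := by simp
  have e2 : (-(2 * n) * W).re = -(2 * n * W.re) := by simp
  have e3 : (2 * n * Complex.I * W).re = -(2 * n * W.im) := by simp
  have e4 : (-(2 * n * Complex.I) * W).re = 2 * n * W.im := by simp
  rw [e1, e2, e3, e4]
  have p1 := Real.exp_pos (2 * n * W.re)
  have p2 := Real.exp_pos (-(2 * n * W.re))
  have p3 := Real.exp_pos (2 * n * W.im)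
  have p4 := Real.exp_pos (-(2 * n * W.im))
  have h := Complex.norm_le_abs_re_add_abs_im W
  rcases le_total |W.re| |W.im| with hc | hc
  · have h1 : Real.exp (n * ‖W‖) ≤ Real.exp |2 * n * W.im| := by
      apply Real.exp_le_exp.mpr
      rw [abs_mul, abs_of_nonneg (by positivity : 0 ≤ 2 * n)]
      nlinarith
    rcases abs_cases (2 * n * W.im) with h2 | h2 <;> rw [h2.1] at h1 <;> linarith
  · have h1 : Real.exp (n * ‖W‖) ≤ Real.exp |2 * n * W.re| := by
      apply Real.exp_le_exp.mpr
      rw [abs_mul, abs_of_nonneg (by positivity : 0 ≤ 2 * n)]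
      nlinarith
    rcases abs_cases (2 * n * W.re) with h2 | h2 <;> rw [h2.1] at h1 <;> linarith

theorem tsum_exp_neg_le : ∑' n : ℕ, ENNReal.ofReal (Real.exp (-(n : ℝ))) ≤ ENNReal.ofReal 2 := by
  have h0 : Real.exp (-1) ≤ 1 / 2 := by
    rw [Real.exp_neg, one_div]
    apply inv_anti₀ (by norm_num)
    have := Real.add_one_le_exp (1 : ℝ); linarith
  calc ∑' n : ℕ, ENNReal.ofReal (Real.exp (-(n : ℝ)))
      ≤ ∑' n : ℕ, ENNReal.ofReal ((1 / 2) ^ n) := by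
        apply ENNReal.tsum_le_tsum
        intro n
        apply ENNReal.ofReal_le_ofReal
        have : Real.exp (-(n : ℝ)) = Real.exp (-1) ^ n := by
          rw [← Real.exp_nat_mul]; ring_nf
        rw [this]
        gcongr
    _ = ENNReal.ofReal (∑' n : ℕ, (1 / 2) ^ n) := by
        rw [ENNReal.ofReal_tsum_of_nonneg (fun n => by positivity) summable_geometric_two]
    _ = _ := by rw [tsum_geometric_two]

/-- the linear form is sub-gaussian: exponential square integrability -/
theorem exp_sq_lin (hδ : 0 < δ) : ∃ c2 C2 : ℝ, 0 < c2 ∧ 0 < C2 ∧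
    ∀ {ι : Type} [Fintype ι] (μ : ι → Measure ℂ), (∀ i, GoodLaw δ D (μ i)) → ∀ b : ι → ℂ,
      ∑ i, ‖b i‖ ^ 2 ≤ 1 →
      ∫⁻ x, ENNReal.ofReal (Real.exp (c2 * ‖∑ i, b i * x i‖ ^ 2)) ∂(Measure.pi μ)
        ≤ ENNReal.ofReal C2 := by
  obtain ⟨C1, hC1, hlin⟩ := GoodLaw.mgf_lin (D := D) hδ
  set q := 4 * C1 + 1 with hq
  have hqp : 0 < q := by positivity
  refine ⟨1 / (4 * q), Real.exp q * (4 * 2), by positivity, by positivity, ?_⟩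
  intro ι _ μ hμ b hb
  have := fun i => (hμ i).prob
  have hlinpi : ∀ a : ℂ, ∫⁻ x, ENNReal.ofReal (Real.exp (a * ∑ i, b i * x i).re) ∂(Measure.pi μ)
      ≤ ENNReal.ofReal (Real.exp (C1 * ‖a‖ ^ 2)) := by
    intro a
    have e : ∀ x : ι → ℂ, (a * ∑ i, b i * x i).re = ∑ i, ((a * b i) * x i).re := by
      intro x; rw [Finset.mul_sum, Complex.re_sum]; simp only [mul_assoc]
    simp only [e]
    refine (lintegral_pi_exp_le μ (fun i z => ((a * b i) * z).re) (fun i => by fun_prop)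
      (fun i => C1 * ‖a * b i‖ ^ 2) (fun i => hlin _ (hμ i) _)).trans ?_
    apply ENNReal.ofReal_le_ofReal
    apply Real.exp_le_exp.mpr
    simp only [norm_mul, mul_pow, ← Finset.mul_sum]
    have : 0 ≤ C1 * ‖a‖ ^ 2 := by positivity
    nlinarith
  set F : ℕ → (ι → ℂ) → ℝ≥0∞ := fun n x =>
    ENNReal.ofReal (Real.exp (-(n ^ 2 * q))) *
    (ENNReal.ofReal (Real.exp (((2 * (n : ℝ) : ℝ) : ℂ) * ∑ i, b i * x i).re)
    + ENNReal.ofReal (Real.exp (((-(2 * (n : ℝ)) : ℝ) : ℂ) * ∑ i, b i * x i).re)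
    + ENNReal.ofReal (Real.exp (((2 * (n : ℝ) : ℝ) : ℂ) * Complex.I * ∑ i, b i * x i).re)
    + ENNReal.ofReal (Real.exp (-(((2 * (n : ℝ) : ℝ) : ℂ) * Complex.I) * ∑ i, b i * x i).re))
    with hF
  have hFm : ∀ n, Measurable (F n) := by
    intro n; simp only [hF]; fun_prop
  have hFi : ∀ n, ∫⁻ x, F n x ∂(Measure.pi μ) ≤ ENNReal.ofReal 4 *
      ENNReal.ofReal (Real.exp (-(n : ℝ))) := by
    intro n
    simp only [hF]
    rw [lintegral_const_mul _ (by fun_prop), lintegral_add_right _ (by fun_prop),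
      lintegral_add_right _ (by fun_prop), lintegral_add_right _ (by fun_prop)]
    have hb : ∀ a : ℂ, ‖a‖ = 2 * n →
        ∫⁻ x, ENNReal.ofReal (Real.exp (a * ∑ i, b i * x i).re) ∂(Measure.pi μ)
          ≤ ENNReal.ofReal (Real.exp (4 * C1 * n ^ 2)) := by
      intro a ha
      refine (hlinpi a).trans (le_of_eq ?_)
      rw [ha]; ring_nf
    calc _ ≤ ENNReal.ofReal (Real.exp (-(n ^ 2 * q))) *
          (ENNReal.ofReal (Real.exp (4 * C1 * n ^ 2)) + ENNReal.ofReal (Real.exp (4 * C1 * n ^ 2))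
          + ENNReal.ofReal (Real.exp (4 * C1 * n ^ 2))
          + ENNReal.ofReal (Real.exp (4 * C1 * n ^ 2))) := by
            gcongr <;> apply hb <;> simp
      _ = ENNReal.ofReal (4 * Real.exp (-(n : ℝ) ^ 2)) := by
        have p := (Real.exp_pos (4 * C1 * n ^ 2)).le
        rw [← ENNReal.ofReal_add p p, ← ENNReal.ofReal_add (by positivity) p,
          ← ENNReal.ofReal_add (by positivity) p, ← ENNReal.ofReal_mul (Real.exp_pos _).le]
        congr 1
        have : Real.exp (-(n : ℝ) ^ 2) = Real.exp (-(n ^ 2 * q)) * Real.exp (4 * C1 * n ^ 2) := by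
          rw [← Real.exp_add, hq]; ring_nf
        rw [this]; ring
      _ ≤ _ := by
        rw [ENNReal.ofReal_mul (by norm_num)]
        gcongr
        have : n ≤ n ^ 2 := Nat.le_self_pow (by norm_num) n
        have h2 : (n : ℝ) ≤ (n : ℝ) ^ 2 := by exact_mod_cast this
        linarith
  calc ∫⁻ x, ENNReal.ofReal (Real.exp (1 / (4 * q) * ‖∑ i, b i * x i‖ ^ 2)) ∂(Measure.pi μ)
      ≤ ∫⁻ x, ENNReal.ofReal (Real.exp q) * ∑' n, F n x ∂(Measure.pi μ) := by
        apply lintegral_mono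
        intro x
        beta_reduce
        obtain ⟨n, hn⟩ := exp_sq_le_aux hqp (norm_nonneg (∑ i, b i * x i))
        calc _ ≤ ENNReal.ofReal (Real.exp q) * F n x := by
              simp only [hF]
              have e : ∀ a b c d : ℂ, ENNReal.ofReal (Real.exp a.re) + ENNReal.ofReal (Real.exp b.re)
                + ENNReal.ofReal (Real.exp c.re) + ENNReal.ofReal (Real.exp d.re)
                = ENNReal.ofReal (Real.exp a.re + Real.exp b.re + Real.exp c.re + Real.exp d.re) := by
                intro a b c d
                rw [ENNReal.ofReal_add (by positivity) (by positivity),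
                  ENNReal.ofReal_add (by positivity) (by positivity),
                  ENNReal.ofReal_add (by positivity) (by positivity)]
              rw [e, ← ENNReal.ofReal_mul (Real.exp_pos _).le,
                ← ENNReal.ofReal_mul (Real.exp_pos _).le]
              apply ENNReal.ofReal_le_ofReal
              have h2 := exp_norm_le n (∑ i, b i * x i) (by positivity)
              rw [div_mul_eq_mul_div, one_mul]
              refine hn.trans ?_
              have hsplit : ∀ u v : ℝ, Real.exp (u - v) = Real.exp (-v) * Real.exp u := by
                intro u v
                rw [← Real.exp_add]; ring_nf
              rw [hsplit]
              gcongr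
              push_cast
              push_cast at h2
              exact h2
          _ ≤ _ := by
              gcongr
              exact ENNReal.le_tsum n
    _ = ENNReal.ofReal (Real.exp q) * ∑' n, ∫⁻ x, F n x ∂(Measure.pi μ) := by
        rw [lintegral_const_mul _ (Measurable.ennreal_tsum hFm), lintegral_tsum
          fun n => (hFm n).aemeasurable]
    _ ≤ ENNReal.ofReal (Real.exp q) * (ENNReal.ofReal 4 * ENNReal.ofReal 2) := by
        gcongr
        refine (ENNReal.tsum_le_tsum hFi).trans ?_
        rw [ENNReal.tsum_mul_left]
        gcongr
        exact tsum_exp_neg_le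
    _ = _ := by
        rw [← ENNReal.ofReal_mul (by norm_num), ← ENNReal.ofReal_mul (Real.exp_pos _).le]

theorem exp_jensen {ι : Type*} [Fintype ι] (w y : ι → ℝ) (hw : ∀ i, 0 ≤ w i)
    (hw1 : ∑ i, w i ≤ 1) : Real.exp (∑ i, w i * y i) ≤ 1 + ∑ i, w i * Real.exp (y i) := by
  set A := ∑ i, w i * y i with hA
  have h1 : ∀ t : ℝ, Real.exp A * (1 + t - A) ≤ Real.exp t := by
    intro t
    have := Real.add_one_le_exp (t - A)
    have e : Real.exp t = Real.exp A * Real.exp (t - A) := by rw [← Real.exp_add]; ring_nf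
    rw [e]
    gcongr
    linarith
  have h2 : Real.exp A * (∑ i, w i + A - A * ∑ i, w i) ≤ ∑ i, w i * Real.exp (y i) := by
    have : Real.exp A * (∑ i, w i + A - A * ∑ i, w i)
        = ∑ i, w i * (Real.exp A * (1 + y i - A)) := by
      nth_rewrite 2 [hA]
      rw [Finset.mul_sum, ← Finset.sum_add_distrib, ← Finset.sum_sub_distrib, Finset.mul_sum]
      apply Finset.sum_congr rfl
      intros; ring
    rw [this]
    exact Finset.sum_le_sum fun i _ => mul_le_mul_of_nonneg_left (h1 _) (hw i)
  have h3 := h1 0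
  rw [Real.exp_zero] at h3
  have h4 : 0 ≤ ∑ i, w i := Finset.sum_nonneg fun i _ => hw i
  nlinarith

theorem bilin_exp (hδ : 0 < δ) : ∃ c3 C3 : ℝ, 0 < c3 ∧ 0 < C3 ∧
    ∀ {α β : Type} [Fintype α] [Fintype β] (μ : α → Measure ℂ) (ν : β → Measure ℂ),
      (∀ i, GoodLaw δ D (μ i)) → (∀ i, GoodLaw δ D (ν i)) → ∀ G : α → β → ℂ,
      ∑ k, ∑ l, ‖G k l‖ ^ 2 ≤ 1 →
      ∫⁻ y, ∫⁻ x, ENNReal.ofReal (Real.exp (c3 * (∑ k, ∑ l, star (x k) * G k l * y l).re))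
        ∂(Measure.pi μ) ∂(Measure.pi ν) ≤ ENNReal.ofReal C3 := by
  obtain ⟨C1, hC1, hlin⟩ := GoodLaw.mgf_lin (D := D) hδ
  obtain ⟨c2, C2, hc2, hC2, hsq⟩ := exp_sq_lin (D := D) hδ
  refine ⟨Real.sqrt (c2 / C1), 1 + C2, by positivity, by positivity, ?_⟩
  intro α β _ _ μ ν hμ hν G hG
  have := fun i => (hμ i).prob
  have := fun i => (hν i).prob
  set c := Real.sqrt (c2 / C1) with hc
  have hcsq : C1 * c ^ 2 = c2 := by
    rw [hc, Real.sq_sqrt (by positivity)]; field_simp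
  set w : α → ℝ := fun k => ∑ l, ‖G k l‖ ^ 2 with hw
  have hw0 : ∀ k, 0 ≤ w k := fun k => Finset.sum_nonneg fun l _ => by positivity
  set bb : α → β → ℂ := fun k l => G k l / (Real.sqrt (w k) : ℂ) with hbb
  have hG2 : ∀ k l, G k l = (Real.sqrt (w k) : ℂ) * bb k l := by
    intro k l
    by_cases h : w k = 0
    · have : ‖G k l‖ ^ 2 = 0 :=
        (Finset.sum_eq_zero_iff_of_nonneg (fun l _ => by positivity)).mp h l (Finset.mem_univ l)
      have : G k l = 0 := by simpa using this
      simp [hbb, h, this]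
    · have h1 : Real.sqrt (w k) ≠ 0 := (Real.sqrt_ne_zero (hw0 k)).mpr h
      have h2 : (Real.sqrt (w k) : ℂ) ≠ 0 := by exact_mod_cast h1
      simp only [hbb]; field_simp
  have hbb1 : ∀ k, ∑ l, ‖bb k l‖ ^ 2 ≤ 1 := by
    intro k
    have : ∑ l, ‖bb k l‖ ^ 2 = w k / w k := by
      simp only [hbb, norm_div, div_pow, Complex.norm_real, Real.norm_eq_abs, sq_abs,
        Real.sq_sqrt (hw0 k)]
      rw [← Finset.sum_div]
    rw [this]; exact div_self_le_one _
  have inner : ∀ y : β → ℂ,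
      ∫⁻ x, ENNReal.ofReal (Real.exp (c * (∑ k, ∑ l, star (x k) * G k l * y l).re)) ∂(Measure.pi μ)
      ≤ 1 + ∑ k, ENNReal.ofReal (w k) *
          ENNReal.ofReal (Real.exp (c2 * ‖∑ l, bb k l * y l‖ ^ 2)) := by
    intro y
    set V : α → ℂ := fun k => ∑ l, G k l * y l with hV
    have e : ∀ x : α → ℂ, c * (∑ k, ∑ l, star (x k) * G k l * y l).re
        = ∑ k, (((c : ℂ) * star (V k)) * x k).re := by
      intro x
      rw [Complex.re_sum, Finset.mul_sum]
      apply Finset.sum_congr rfl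
      intro k _
      have : ∑ l, star (x k) * G k l * y l = star (x k) * V k := by
        rw [hV, Finset.mul_sum]; simp only [mul_assoc]
      rw [this]; simp; ring
    simp only [e]
    refine (lintegral_pi_exp_le μ (fun k z => (((c : ℂ) * star (V k)) * z).re)
      (fun i => by fun_prop) (fun k => C1 * ‖(c : ℂ) * star (V k)‖ ^ 2)
      (fun i => hlin _ (hμ i) _)).trans ?_
    have e2 : ∀ k, C1 * ‖(c : ℂ) * star (V k)‖ ^ 2
        = w k * (c2 * ‖∑ l, bb k l * y l‖ ^ 2) := by
      intro k
      have : V k = (Real.sqrt (w k) : ℂ) * ∑ l, bb k l * y l := by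
        rw [Finset.mul_sum]
        simp only [hV]
        apply Finset.sum_congr rfl
        intro l _
        rw [hG2 k l]; ring
      rw [norm_mul, norm_star, this, norm_mul, Complex.norm_real, Complex.norm_real, mul_pow,
        mul_pow, Real.norm_eq_abs, Real.norm_eq_abs, sq_abs, sq_abs, Real.sq_sqrt (hw0 k),
        ← hcsq]
      ring
    simp only [e2]
    rw [← ENNReal.ofReal_one]
    simp only [← ENNReal.ofReal_mul (hw0 _)]
    rw [← ENNReal.ofReal_sum_of_nonneg (fun k _ => mul_nonneg (hw0 k) (Real.exp_pos _).le),
      ← ENNReal.ofReal_add zero_le_one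
        (Finset.sum_nonneg fun k _ => mul_nonneg (hw0 k) (Real.exp_pos _).le)]
    exact ENNReal.ofReal_le_ofReal (exp_jensen w _ hw0 hG)
  calc _ ≤ ∫⁻ y, (1 + ∑ k, ENNReal.ofReal (w k) *
          ENNReal.ofReal (Real.exp (c2 * ‖∑ l, bb k l * y l‖ ^ 2))) ∂(Measure.pi ν) :=
        lintegral_mono inner
    _ = 1 + ∑ k, ENNReal.ofReal (w k) *
          ∫⁻ y, ENNReal.ofReal (Real.exp (c2 * ‖∑ l, bb k l * y l‖ ^ 2)) ∂(Measure.pi ν) := by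
        rw [lintegral_add_left (by fun_prop), lintegral_finsetSum _ (fun k _ => by fun_prop)]
        congr 1
        · simp
        · apply Finset.sum_congr rfl
          intro k _
          rw [lintegral_const_mul _ (by fun_prop)]
    _ ≤ 1 + ∑ k, ENNReal.ofReal (w k) * ENNReal.ofReal C2 := by
        gcongr with k
        exact hsq ν hν _ (hbb1 k)
    _ = 1 + ENNReal.ofReal (∑ k, w k) * ENNReal.ofReal C2 := by
        rw [← Finset.sum_mul, ENNReal.ofReal_sum_of_nonneg fun k _ => hw0 k]
    _ ≤ _ := by
        rw [ENNReal.ofReal_add zero_le_one hC2.le, ENNReal.ofReal_one]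
        gcongr
        have : ENNReal.ofReal (∑ k, w k) ≤ 1 := by
          rw [← ENNReal.ofReal_one]; exact ENNReal.ofReal_le_ofReal hG
        calc _ ≤ 1 * ENNReal.ofReal C2 := by gcongr
          _ = _ := one_mul _

end QF2

section QF3
variable {δ D : ℝ}

theorem decoup0 {ι : Type} [Fintype ι] (μ : ι → Measure ℂ) (hμ : ∀ i, IsProbabilityMeasure (μ i))
    (p : ι → Prop) [DecidablePred p]
    (g : ({i // p i} → ℂ) × ({i // ¬ p i} → ℂ) → ℝ≥0∞) (hg : Measurable g) :
    ∫⁻ x, g (fun i => x i.1, fun i => x i.1) ∂(Measure.pi μ)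
      = ∫⁻ y, ∫⁻ x, g (x, y) ∂(Measure.pi fun i : {i // p i} => μ i.1)
        ∂(Measure.pi fun i : {i // ¬ p i} => μ i.1) := by
  have h1 := (measurePreserving_piEquivPiSubtypeProd μ p).lintegral_comp hg
  rw [← lintegral_prod_symm _ hg.aemeasurable]
  exact h1

theorem decoup {c3 C3 : ℝ}
    (hbil : ∀ {α β : Type} [Fintype α] [Fintype β] (μ : α → Measure ℂ) (ν : β → Measure ℂ),
      (∀ i, GoodLaw δ D (μ i)) → (∀ i, GoodLaw δ D (ν i)) → ∀ G : α → β → ℂ,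
      ∑ k, ∑ l, ‖G k l‖ ^ 2 ≤ 1 →
      ∫⁻ y, ∫⁻ x, ENNReal.ofReal (Real.exp (c3 * (∑ k, ∑ l, star (x k) * G k l * y l).re))
        ∂(Measure.pi μ) ∂(Measure.pi ν) ≤ ENNReal.ofReal C3)
    {ι : Type} [Fintype ι] [DecidableEq ι] (μ : ι → Measure ℂ) (hμ : ∀ i, GoodLaw δ D (μ i))
    (G : ι → ι → ℂ) (hG : ∑ k, ∑ l, ‖G k l‖ ^ 2 ≤ 1) (p : ι → Prop) [DecidablePred p] :
    ∫⁻ x, ENNReal.ofReal (Real.exp (c3 * (∑ k : {i // p i}, ∑ l : {i // ¬ p i},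
      star (x k.1) * G k.1 l.1 * x l.1).re))
      ∂(Measure.pi μ) ≤ ENNReal.ofReal C3 := by
  have h1 := decoup0 μ (fun i => (hμ i).prob) p (fun q =>
    ENNReal.ofReal (Real.exp (c3 * (∑ k, ∑ l, star (q.1 k) * G k.1 l.1 * q.2 l).re)))
    (by fun_prop)
  refine (le_of_eq h1).trans ?_
  have h2 := hbil (fun i : {i // p i} => μ i.1) (fun i : {i // ¬ p i} => μ i.1)
    (fun i => hμ i.1) (fun i => hμ i.1) (fun k l => G k.1 l.1)
  apply h2
  refine le_trans ?_ hG
  have sle : ∀ (q : ι → Prop) [DecidablePred q] (f : ι → ℝ), (∀ i, 0 ≤ f i) → ∑ k : {i // q i}, f k.1 ≤ ∑ k, f k := by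
    intro q _ f hf
    rw [← Finset.sum_subtype (Finset.univ.filter q) (by simp)]
    exact Finset.sum_le_sum_of_subset_of_nonneg (Finset.subset_univ _) (fun _ _ _ => hf _)
  refine le_trans ?_ (sle p (fun k => ∑ l, ‖G k l‖ ^ 2)
    (fun _ => Finset.sum_nonneg fun _ _ => by positivity))
  exact Finset.sum_le_sum fun k _ => sle (fun i => ¬ p i) (fun l => ‖G k.1 l‖ ^ 2)
    (fun _ => by positivity)

theorem sum_decoup {ι : Type} [Fintype ι] [DecidableEq ι] (f : ι → ι → ℝ) :
    4 * ∑ S : Finset ι, ∑ k : {i // i ∈ S}, ∑ l : {i // ¬ i ∈ S}, f k.1 l.1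
      = 2 ^ Fintype.card ι * ∑ k, ∑ l, if k = l then 0 else f k l := by
  have cnt : ∀ k l : ι, k ≠ l →
      (4:ℝ) * ∑ S : Finset ι, (if k ∈ S ∧ l ∈ Sᶜ then (1:ℝ) else 0) = 2 ^ Fintype.card ι := by
    intro k l hkl
    have h1 : (Finset.univ.filter fun S : Finset ι => k ∈ S ∧ l ∈ Sᶜ) = Finset.Icc {k} {l}ᶜ := by
      ext S
      simp only [Finset.mem_filter, Finset.mem_univ, true_and, Finset.mem_compl, Finset.mem_Icc,
        Finset.singleton_subset_iff]
      refine and_congr_right fun _ => ⟨fun h x hx => ?_, fun h h2 => ?_⟩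
      · simp only [Finset.mem_compl, Finset.mem_singleton]; rintro rfl; exact h hx
      · simpa using h h2
    have h2 : ({k} : Finset ι) ⊆ {l}ᶜ := by simp [hkl.symm]
    have hc : 2 ≤ Fintype.card ι := by
      have : ({k, l} : Finset ι).card ≤ Fintype.card ι := Finset.card_le_univ _
      rwa [Finset.card_pair hkl] at this
    rw [← Finset.sum_filter, h1, Finset.sum_const, Finset.card_Icc_finset h2, Finset.card_compl,
      Finset.card_singleton, Finset.card_singleton]
    obtain ⟨m, hm⟩ := Nat.exists_eq_add_of_le hc
    rw [hm, show 2 + m - 1 - 1 = m by omega]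
    simp; ring
  have e : ∀ S : Finset ι, ∑ k : {i // i ∈ S}, ∑ l : {i // ¬ i ∈ S}, f k.1 l.1
      = ∑ k, ∑ l, (if k ∈ S ∧ l ∈ Sᶜ then (1:ℝ) else 0) * f k l := by
    intro S
    simp only [ite_and, ite_mul, one_mul, zero_mul]
    rw [← Finset.sum_subtype (Finset.univ.filter fun i => i ∈ S) (by simp)
      (fun k => ∑ l : {i // ¬ i ∈ S}, f k l.1), Finset.sum_filter]
    apply Finset.sum_congr rfl
    intro k _
    split_ifs
    · rw [← Finset.sum_subtype (Finset.univ.filter fun i => ¬ i ∈ S) (by simp)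
        (fun l => f k l), Finset.sum_filter]
      simp only [Finset.mem_compl]
    · simp
  simp only [e]
  rw [Finset.sum_comm, Finset.mul_sum, Finset.mul_sum]
  apply Finset.sum_congr rfl
  intro k _
  rw [Finset.sum_comm, Finset.mul_sum, Finset.mul_sum]
  apply Finset.sum_congr rfl
  intro l _
  rw [← Finset.sum_mul, ← mul_assoc]
  split_ifs with h
  · subst h
    simp
  · rw [cnt k l h]

theorem off_exp (hδ : 0 < δ) : ∃ c3 C3 : ℝ, 0 < c3 ∧ 0 < C3 ∧
    ∀ {ι : Type} [Fintype ι] [DecidableEq ι] (μ : ι → Measure ℂ), (∀ i, GoodLaw δ D (μ i)) →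
      ∀ (G : ι → ι → ℂ), ∑ k, ∑ l, ‖G k l‖ ^ 2 ≤ 1 → ∀ c : ℝ, 0 ≤ c → c ≤ c3 →
      ∫⁻ x, ENNReal.ofReal (Real.exp (c *
        (∑ k, ∑ l, if k = l then 0 else (star (x k) * G k l * x l).re)))
        ∂(Measure.pi μ) ≤ ENNReal.ofReal C3 := by
  obtain ⟨c3, C3, hc3, hC3, hbil⟩ := bilin_exp (D := D) hδ
  refine ⟨c3 / 4, 1 + C3, by positivity, by positivity, ?_⟩
  intro ι _ _ μ hμ G hG c hc hcc
  have := fun i => (hμ i).prob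
  set r : ℝ := 4 * c / c3 with hr
  have hr0 : 0 ≤ r := by positivity
  have hr1 : r ≤ 1 := by rw [hr, div_le_one hc3]; linarith
  have hG' : ∑ k, ∑ l, ‖(r : ℂ) * G k l‖ ^ 2 ≤ 1 := by
    have : ∑ k, ∑ l, ‖(r : ℂ) * G k l‖ ^ 2 = r ^ 2 * ∑ k, ∑ l, ‖G k l‖ ^ 2 := by
      simp only [norm_mul, mul_pow, Complex.norm_real, Real.norm_eq_abs, sq_abs, Finset.mul_sum]
    rw [this]
    have h0 : 0 ≤ ∑ k, ∑ l, ‖G k l‖ ^ 2 :=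
      Finset.sum_nonneg fun _ _ => Finset.sum_nonneg fun _ _ => by positivity
    have : r ^ 2 ≤ 1 := by nlinarith
    nlinarith
  have hd := fun S : Finset ι => decoup hbil μ hμ (fun k l => (r : ℂ) * G k l) hG' (fun i => i ∈ S)
  set n := Fintype.card ι with hn
  set y : (ι → ℂ) → Finset ι → ℝ := fun x S => c3 * (∑ k : {i // i ∈ S}, ∑ l : {i // ¬ i ∈ S},
      star (x k.1) * ((r : ℂ) * G k.1 l.1) * x l.1).re with hy
  have key : ∀ x : ι → ℂ, c * (∑ k, ∑ l, if k = l then 0 else (star (x k) * G k l * x l).re)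
      = ∑ S : Finset ι, (1 / 2 ^ n : ℝ) * y x S := by
    intro x
    have h1 := sum_decoup (fun k l => (star (x k) * G k l * x l).re)
    have h2 : ∀ S, y x S = 4 * c * ∑ k : {i // i ∈ S}, ∑ l : {i // ¬ i ∈ S},
        (star (x k.1) * G k.1 l.1 * x l.1).re := by
      intro S
      have e : ∀ a b d : ℂ, (a * (r * b) * d).re = r * (a * b * d).re := by
        intro a b d
        have : a * (r * b) * d = r * (a * b * d) := by ring
        rw [this]; simp
      simp only [hy, Complex.re_sum, e, ← Finset.mul_sum]
      rw [← mul_assoc]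
      congr 1
      rw [hr]; field_simp
    simp only [h2]
    rw [← Finset.mul_sum, ← Finset.mul_sum]
    rw [← hn] at h1
    have hp : (0:ℝ) < 2 ^ n := by positivity
    field_simp
    linear_combination (-c) * h1
  have hw1 : ∑ S : Finset ι, (1 / 2 ^ n : ℝ) ≤ 1 := by
    rw [Finset.sum_const, Finset.card_univ, Fintype.card_finset, ← hn]
    simp
  have hym : ∀ S, Measurable fun x => y x S := by
    intro S; simp only [hy]; fun_prop
  calc _ ≤ ∫⁻ x, (1 + ∑ S : Finset ι, ENNReal.ofReal (1 / 2 ^ n) * ENNReal.ofReal (Real.exp (y x S)))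
          ∂(Measure.pi μ) := by
        apply lintegral_mono
        intro x
        beta_reduce
        rw [key, ← ENNReal.ofReal_one]
        simp only [← ENNReal.ofReal_mul (show (0:ℝ) ≤ 1 / 2 ^ n by positivity)]
        rw [← ENNReal.ofReal_sum_of_nonneg (fun S _ => by positivity),
          ← ENNReal.ofReal_add zero_le_one (Finset.sum_nonneg fun _ _ => by positivity)]
        exact ENNReal.ofReal_le_ofReal (exp_jensen _ _ (fun _ => by positivity) hw1)
    _ = 1 + ∑ S : Finset ι, ENNReal.ofReal (1 / 2 ^ n) *
          ∫⁻ x, ENNReal.ofReal (Real.exp (y x S)) ∂(Measure.pi μ) := by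
        rw [lintegral_add_left (by fun_prop), lintegral_finsetSum _ (fun k _ => by
          have := hym k; fun_prop)]
        congr 1
        · simp
        · apply Finset.sum_congr rfl
          intro S _
          have := hym S
          rw [lintegral_const_mul _ (by fun_prop)]
    _ ≤ 1 + ∑ S : Finset ι, ENNReal.ofReal (1 / 2 ^ n) * ENNReal.ofReal C3 := by
        gcongr with S
        refine le_trans (le_of_eq ?_) (hd S); simp only [hy]; congr!
    _ ≤ ENNReal.ofReal (1 + C3) := by
        rw [ENNReal.ofReal_add zero_le_one hC3.le, ENNReal.ofReal_one, ← Finset.sum_mul,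
          ← ENNReal.ofReal_sum_of_nonneg (fun S _ => by positivity)]
        gcongr
        calc _ ≤ ENNReal.ofReal 1 * ENNReal.ofReal C3 := by gcongr
          _ = _ := by simp

theorem diag_exp (hδ : 0 < δ) : ∃ C5 : ℝ, 0 < C5 ∧
    ∀ {ι : Type} [Fintype ι] (μ : ι → Measure ℂ), (∀ i, GoodLaw δ D (μ i)) →
      ∀ (g : ι → ℝ), ∑ k, g k ^ 2 ≤ 1 → ∀ c : ℝ, 0 ≤ c → c ≤ δ / 2 →
      ∫⁻ x, ENNReal.ofReal (Real.exp (c * (∑ k, g k * (‖x k‖ ^ 2 - 1))))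
        ∂(Measure.pi μ) ≤ ENNReal.ofReal (Real.exp (C5 * c ^ 2)) := by
  obtain ⟨C5, hC5, h5⟩ := GoodLaw.mgf_sq (D := D) hδ
  refine ⟨C5, hC5, ?_⟩
  intro ι _ μ hμ g hg c hc hcc
  have := fun i => (hμ i).prob
  have e : ∀ x : ι → ℂ, c * (∑ k, g k * (‖x k‖ ^ 2 - 1)) = ∑ k, (c * g k) * (‖x k‖ ^ 2 - 1) := by
    intro x; rw [Finset.mul_sum]; simp only [mul_assoc]
  simp only [e]
  have hg1 : ∀ k, |g k| ≤ 1 := by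
    intro k
    have : g k ^ 2 ≤ 1 :=
      (Finset.single_le_sum (f := fun k => g k ^ 2) (fun i _ => sq_nonneg _) (Finset.mem_univ k)).trans hg
    exact (sq_le_one_iff_abs_le_one _).mp this
  refine (lintegral_pi_exp_le μ (fun k z => (c * g k) * (‖z‖ ^ 2 - 1)) (fun i => by fun_prop)
    (fun k => C5 * (c * g k) ^ 2) (fun k => h5 _ (hμ k) _ ?_)).trans ?_
  · rw [abs_mul, abs_of_nonneg hc]
    calc c * |g k| ≤ c * 1 := by gcongr; exact hg1 k
      _ ≤ _ := by linarith
  · apply ENNReal.ofReal_le_ofReal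
    apply Real.exp_le_exp.mpr
    simp only [mul_pow, ← Finset.mul_sum]
    gcongr
    nlinarith [sq_nonneg c]

theorem qf_exp (hδ : 0 < δ) : ∃ c C : ℝ, 0 < c ∧ 0 < C ∧
    ∀ {ι : Type} [Fintype ι] [DecidableEq ι] (μ : ι → Measure ℂ), (∀ i, GoodLaw δ D (μ i)) →
      ∀ (G : ι → ι → ℂ), ∑ k, ∑ l, ‖G k l‖ ^ 2 ≤ 1 →
      ∫⁻ x, ENNReal.ofReal (Real.exp (c *
        (∑ k, ∑ l, star (x k) * G k l * x l - ∑ k, G k k).re))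
        ∂(Measure.pi μ) ≤ ENNReal.ofReal C := by
  obtain ⟨c3, C3, hc3, hC3, hoff⟩ := off_exp (D := D) hδ
  obtain ⟨C5, hC5, hdiag⟩ := diag_exp (D := D) hδ
  set d := min c3 (δ / 2) with hd
  have hd0 : 0 < d := lt_min hc3 (by positivity)
  refine ⟨d / 2, C3 + Real.exp (C5 * d ^ 2), by positivity, by positivity, ?_⟩
  intro ι _ _ μ hμ G hG
  have := fun i => (hμ i).prob
  have h1 := hoff μ hμ G hG d hd0.le (min_le_left _ _)
  have hg : ∑ k, (G k k).re ^ 2 ≤ 1 := by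
    refine le_trans ?_ hG
    apply Finset.sum_le_sum
    intro k _
    have a : ‖G k k‖ ^ 2 ≤ ∑ l, ‖G k l‖ ^ 2 :=
      Finset.single_le_sum (f := fun l => ‖G k l‖ ^ 2) (fun i _ => sq_nonneg _) (Finset.mem_univ k)
    have b := Complex.abs_re_le_norm (G k k)
    have : (G k k).re ^ 2 ≤ ‖G k k‖ ^ 2 := by
      rw [← sq_abs]; gcongr
    linarith
  have h2 := hdiag μ hμ (fun k => (G k k).re) hg d hd0.le (min_le_right _ _)
  set U : (ι → ℂ) → ℝ := fun x => ∑ k, ∑ l, if k = l then 0 else (star (x k) * G k l * x l).re with hU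
  set V : (ι → ℂ) → ℝ := fun x => ∑ k, (G k k).re * (‖x k‖ ^ 2 - 1) with hV
  have e : ∀ x : ι → ℂ, (∑ k, ∑ l, star (x k) * G k l * x l - ∑ k, G k k).re = U x + V x := by
    intro x
    rw [← Finset.sum_sub_distrib, Complex.re_sum, ← Finset.sum_add_distrib]
    apply Finset.sum_congr rfl
    intro k _
    have a : ∑ l, star (x k) * G k l * x l
        = (∑ l, if k = l then 0 else star (x k) * G k l * x l) + star (x k) * G k k * x k := by
      have : ∀ l, star (x k) * G k l * x l = (if k = l then 0 else star (x k) * G k l * x l)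
          + (if k = l then star (x k) * G k l * x l else 0) := by
        intro l; split_ifs <;> simp
      rw [Finset.sum_congr rfl fun l _ => this l, Finset.sum_add_distrib]
      simp
    have b : star (x k) * G k k * x k = (‖x k‖ ^ 2 : ℝ) * G k k := by
      have := Complex.conj_mul' (x k)
      simp only [Complex.star_def]
      push_cast
      rw [← this]; ring
    have c : ∀ l, (if k = l then (0:ℂ) else star (x k) * G k l * x l).re
       = if k = l then 0 else (star (x k) * G k l * x l).re := by
      intro l; split_ifs <;> simp
    rw [a, b, Complex.sub_re, Complex.add_re, Complex.re_sum, Complex.re_ofReal_mul]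
    simp only [c]
    ring
  have hUm : Measurable U := by
    simp only [hU]
    refine Finset.measurable_sum _ fun k _ => Finset.measurable_sum _ fun l _ => ?_
    split_ifs <;> fun_prop
  calc _ ≤ ∫⁻ x, (ENNReal.ofReal (Real.exp (d * U x)) + ENNReal.ofReal (Real.exp (d * V x)))
        ∂(Measure.pi μ) := by
        apply lintegral_mono
        intro x
        beta_reduce
        rw [e, ← ENNReal.ofReal_add (by positivity) (by positivity)]
        apply ENNReal.ofReal_le_ofReal
        have s1 : Real.exp (d * U x) = Real.exp (d / 2 * U x) ^ 2 := by
          rw [← Real.exp_nat_mul]; congr 1; push_cast; ring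
        have s2 : Real.exp (d * V x) = Real.exp (d / 2 * V x) ^ 2 := by
          rw [← Real.exp_nat_mul]; congr 1; push_cast; ring
        rw [mul_add, Real.exp_add, s1, s2]
        nlinarith [sq_nonneg (Real.exp (d / 2 * U x) - Real.exp (d / 2 * V x)),
          sq_nonneg (Real.exp (d / 2 * U x)), sq_nonneg (Real.exp (d / 2 * V x))]
    _ ≤ _ := by
        rw [lintegral_add_left (by fun_prop), ENNReal.ofReal_add hC3.le (Real.exp_pos _).le]
        exact add_le_add h1 h2

theorem qf_tail (hδ : 0 < δ) : ∃ c C : ℝ, 0 < c ∧ 0 < C ∧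
    ∀ {ι : Type} [Fintype ι] [DecidableEq ι] (μ : ι → Measure ℂ), (∀ i, GoodLaw δ D (μ i)) →
      ∀ (G : ι → ι → ℂ) (s : ℝ), 0 < s → ∑ k, ∑ l, ‖G k l‖ ^ 2 ≤ s ^ 2 → ∀ t : ℝ,
      Measure.pi μ {x | t < ‖∑ k, ∑ l, star (x k) * G k l * x l - ∑ k, G k k‖}
        ≤ ENNReal.ofReal (C * Real.exp (-(c * (t / s)))) := by
  obtain ⟨c, C, hc, hC, hq⟩ := qf_exp (D := D) hδ
  refine ⟨c / 2, 4 * C, by positivity, by positivity, ?_⟩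
  intro ι _ _ μ hμ G s hs hG t
  have := fun i => (hμ i).prob
  set X : (ι → ℂ) → ℂ := fun x => ∑ k, ∑ l, star (x k) * G k l * x l - ∑ k, G k k with hX
  have hXm : Measurable X := by simp only [hX]; fun_prop
  have one : ∀ θ : ℂ, ‖θ‖ = 1 → Measure.pi μ {x | t / 2 ≤ (θ * X x).re}
      ≤ ENNReal.ofReal (C * Real.exp (-(c / 2 * (t / s)))) := by
    intro θ hθ
    have h1 := hq μ hμ (fun k l => (θ / s) * G k l) (by
      have : ∑ k, ∑ l, ‖(θ / s) * G k l‖ ^ 2 = (1 / s ^ 2) * ∑ k, ∑ l, ‖G k l‖ ^ 2 := by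
        simp only [norm_mul, norm_div, hθ, mul_pow, Complex.norm_real, Real.norm_eq_abs, div_pow,
          sq_abs, Finset.mul_sum, one_pow]
      rw [this, one_div_mul_eq_div, div_le_one (by positivity)]
      exact hG)
    have e : ∀ x : ι → ℂ, (∑ k, ∑ l, star (x k) * ((θ / s) * G k l) * x l - ∑ k, (θ / s) * G k k).re
        = (θ * X x).re / s := by
      intro x
      have : ∑ k, ∑ l, star (x k) * ((θ / s) * G k l) * x l - ∑ k, (θ / s) * G k k
          = ((1 / s : ℝ) : ℂ) * (θ * X x) := by
        simp only [hX, mul_sub, Finset.mul_sum]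
        congr 1
        · refine Finset.sum_congr rfl fun k _ => Finset.sum_congr rfl fun l _ => ?_
          push_cast; ring
        · refine Finset.sum_congr rfl fun k _ => ?_
          push_cast; ring
      rw [this, Complex.re_ofReal_mul]; ring
    simp only [e] at h1
    have h2 : ∀ x, x ∈ {x | t / 2 ≤ (θ * X x).re} → ENNReal.ofReal (Real.exp (c * (t / 2 / s)))
        ≤ ENNReal.ofReal (Real.exp (c * ((θ * X x).re / s))) := by
      intro x hx
      simp only [Set.mem_ofPred_eq] at hx
      gcongr
    have h3 : ENNReal.ofReal (Real.exp (c * (t / 2 / s))) * Measure.pi μ {x | t / 2 ≤ (θ * X x).re}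
        ≤ ENNReal.ofReal C := by
      refine le_trans ?_ h1
      refine le_trans (mul_le_mul_right (measure_mono h2) _) ?_
      exact mul_meas_ge_le_lintegral (by fun_prop) _
    have hne : ENNReal.ofReal (Real.exp (c * (t / 2 / s))) ≠ 0 := by
      simp [Real.exp_pos]
    have h4 := (ENNReal.le_div_iff_mul_le (Or.inl hne) (Or.inl ENNReal.ofReal_ne_top)).mpr
      ((mul_comm _ _).le.trans h3)
    refine h4.trans (le_of_eq ?_)
    rw [← ENNReal.ofReal_div_of_pos (Real.exp_pos _)]
    congr 1
    rw [div_eq_mul_inv, ← Real.exp_neg]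
    congr 2; ring
  have hsub : {x | t < ‖X x‖} ⊆ (({x | t / 2 ≤ ((1:ℂ) * X x).re} ∪ {x | t / 2 ≤ ((-1:ℂ) * X x).re})
      ∪ {x | t / 2 ≤ (Complex.I * X x).re}) ∪ {x | t / 2 ≤ ((-Complex.I) * X x).re} := by
    intro x hx
    simp only [Set.mem_ofPred_eq] at hx
    have h1 := Complex.norm_le_abs_re_add_abs_im (X x)
    by_contra hcon
    simp only [Set.mem_union, Set.mem_ofPred_eq, not_or, not_le, neg_mul, one_mul, Complex.neg_re,
      Complex.mul_re, Complex.I_re, Complex.I_im, zero_mul, zero_sub, neg_neg] at hcon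
    obtain ⟨⟨⟨a, b⟩, c⟩, d⟩ := hcon
    have : |(X x).re| < t / 2 := abs_lt.mpr ⟨by linarith, a⟩
    have : |(X x).im| < t / 2 := abs_lt.mpr ⟨by linarith, d⟩
    linarith
  refine (measure_mono hsub).trans ?_
  refine (measure_union_le _ _).trans ?_
  have hp : 0 ≤ C * Real.exp (-(c / 2 * (t / s))) := by positivity
  have : 4 * C * Real.exp (-(c / 2 * (t / s))) = ((C * Real.exp (-(c / 2 * (t / s)))
    + C * Real.exp (-(c / 2 * (t / s)))) + C * Real.exp (-(c / 2 * (t / s))))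
    + C * Real.exp (-(c / 2 * (t / s))) := by ring
  rw [this, ENNReal.ofReal_add (by positivity) hp, ENNReal.ofReal_add (by positivity) hp,
    ENNReal.ofReal_add hp hp]
  gcongr
  · refine (measure_union_le _ _).trans ?_
    gcongr
    · refine (measure_union_le _ _).trans ?_
      gcongr
      · exact one 1 (by simp)
      · exact one (-1) (by simp)
    · exact one _ (by simp)
  · exact one _ (by simp)

end QF3

section Prob

theorem GoodLaw.conj {δ D : ℝ} {μ : Measure ℂ} (h : GoodLaw δ D μ) :
    GoodLaw δ D (μ.map (fun z => star z)) := by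
  have hm : Measurable (fun z : ℂ => star z) := by fun_prop
  have := h.prob
  refine ⟨Measure.isProbabilityMeasure_map hm.aemeasurable, ?_, ?_, ?_⟩
  · rw [integral_map hm.aemeasurable (by fun_prop)]
    have : ∫ z, star z ∂μ = star (∫ z, z ∂μ) := integral_conj
    rw [this, h.mean]; simp
  · rw [integral_map hm.aemeasurable (by fun_prop)]
    simpa using h.var
  · rw [lintegral_map (by fun_prop) hm]
    simpa using h.expm

theorem resol_meas {κ : Type} [Fintype κ] [DecidableEq κ] (z : ℂ) (k l : κ) :
    Measurable fun y : κ → κ → ℂ => resol (Matrix.of y) z k l := by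
  simp only [resol, Matrix.inv_def, Matrix.smul_apply, Ring.inverse_eq_inv', smul_eq_mul]
  have hc : Continuous fun y : κ → κ → ℂ => (Matrix.of y - z • (1 : Matrix κ κ ℂ)) := by
    refine Continuous.sub ?_ continuous_const
    exact continuous_id
  refine Measurable.mul (Measurable.inv ?_) ?_
  · exact hc.matrix_det.measurable
  · exact (hc.matrix_adjugate.matrix_elem k l).measurable

variable {Ω : Type} [MeasurableSpace Ω] {P : Measure Ω} {N : ℕ}
    {H : Ω → Matrix (Fin N) (Fin N) ℂ} {ν : Measure ℂ} {ν' : Measure ℝ} {δ D D' : ℝ}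

theorem IsWignerMatrix.aem (hW : IsWignerMatrix P N H ν ν') (hN : 0 < N) (i j : Fin N) :
    AEMeasurable (fun ω => H ω i j) P := by
  have hp := hW.probν
  have hp' := hW.probν'
  have hs : (Real.sqrt N : ℂ) ≠ 0 := by
    have : Real.sqrt N ≠ 0 := by positivity
    exact_mod_cast this
  have hlt : ∀ i j : Fin N, i < j → AEMeasurable (fun ω => H ω i j) P := by
    intro i j hij
    have h1 : AEMeasurable (fun ω => (Real.sqrt N : ℂ) * H ω i j) P := by
      apply AEMeasurable.of_map_ne_zero
      rw [hW.offdiag i j hij]; exact IsProbabilityMeasure.ne_zero _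
    have : (fun ω => H ω i j) = fun ω => (Real.sqrt N : ℂ)⁻¹ * ((Real.sqrt N : ℂ) * H ω i j) := by
      ext ω; field_simp
    rw [this]; exact h1.const_mul _
  rcases lt_trichotomy i j with h | h | h
  · exact hlt i j h
  · subst h
    have h1 : AEMeasurable (fun ω => Real.sqrt N * (H ω i i).re) P := by
      apply AEMeasurable.of_map_ne_zero
      rw [hW.diag i]; exact IsProbabilityMeasure.ne_zero _
    have : (fun ω => H ω i i)
        = fun ω => (((Real.sqrt N)⁻¹ * (Real.sqrt N * (H ω i i).re) : ℝ) : ℂ) := by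
      ext ω
      have : Real.sqrt N ≠ 0 := by positivity
      rw [← mul_assoc, inv_mul_cancel₀ this, one_mul]
      apply Complex.ext
      · simp
      · simp [hW.diag_real]
    rw [this]
    exact Complex.measurable_ofReal.comp_aemeasurable (h1.const_mul _)
  · have : (fun ω => H ω i j) = fun ω => star (H ω j i) := by
      ext ω; exact ((hW.herm ω).apply i j).symm
    rw [this]
    exact (continuous_star.measurable).comp_aemeasurable (hlt j i h)

/-- sorted index -/
def ixp (k l : Fin N) : {p : Fin N × Fin N // p.1 ≤ p.2} := ⟨(min k l, max k l), min_le_max⟩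

/-- conditional conjugation -/
def cjj (k l : Fin N) (z : ℂ) : ℂ := if k ≤ l then z else star z

theorem cjj_meas (k l : Fin N) : Measurable (cjj k l) := by
  unfold cjj; split_ifs <;> fun_prop

theorem cjj_eq {A : Matrix (Fin N) (Fin N) ℂ} (hA : A.IsHermitian) (k l : Fin N) :
    A k l = cjj k l (A (ixp k l).1.1 (ixp k l).1.2) := by
  unfold cjj ixp
  split_ifs with h
  · simp [h]
  · have h' := (not_le.mp h).le
    simp only [min_eq_right h', max_eq_left h']
    exact (hA.apply k l).symm

theorem IsWignerMatrix.col_good (hW : IsWignerMatrix P N H ν ν') (hC : CondC1 ν ν' δ D D')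
    (hN : 0 < N) (k i : Fin N) (hki : k ≠ i) :
    GoodLaw δ D (P.map (fun ω => (Real.sqrt N : ℂ) * H ω k i)) := by
  have hg : GoodLaw δ D ν := ⟨hW.probν, hW.mean, hW.var, hC.2.1⟩
  rcases lt_or_gt_of_ne hki with h | h
  · rw [hW.offdiag k i h]; exact hg
  · have e : (fun ω => (Real.sqrt N : ℂ) * H ω k i)
        = (fun z => star z) ∘ (fun ω => (Real.sqrt N : ℂ) * H ω i k) := by
      ext ω
      simp only [Function.comp, star_mul']
      rw [(hW.herm ω).apply k i]
      simp
    have := hW.aem hN i k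
    rw [e, ← AEMeasurable.map_map_of_aemeasurable (by fun_prop) (by fun_prop), hW.offdiag i k h]
    exact hg.conj

theorem IsWignerMatrix.joint (hW : IsWignerMatrix P N H ν ν') (hN : 0 < N) (i : Fin N) :
    P.map (fun ω => ((fun (k l : {k // k ≠ i}) => H ω k l),
        (fun k : {k // k ≠ i} => (Real.sqrt N : ℂ) * H ω k i)))
      = (P.map (fun ω => (fun (k l : {k // k ≠ i}) => H ω k l))).prod
        (Measure.pi fun k : {k // k ≠ i} => P.map (fun ω => (Real.sqrt N : ℂ) * H ω k i)) := by
  have := hW.prob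
  have haem := hW.aem hN
  have hZ : ∀ p : {p : Fin N × Fin N // p.1 ≤ p.2}, AEMeasurable (fun ω => H ω p.1.1 p.1.2) P :=
    fun p => haem _ _
  have hcol : P.map (fun ω => (fun k : {k // k ≠ i} => (Real.sqrt N : ℂ) * H ω k i))
      = Measure.pi fun k : {k // k ≠ i} => P.map (fun ω => (Real.sqrt N : ℂ) * H ω k i) := by
    rw [← iIndepFun_iff_map_fun_eq_pi_map (fun k => (haem _ _).const_mul _)]
    have hinj : Function.Injective (fun k : {k // k ≠ i} => ixp k.1 i) := by
      intro k k' h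
      simp only [ixp, Subtype.mk.injEq, Prod.mk.injEq] at h
      apply Subtype.ext
      have a := k.2
      have b := k'.2
      obtain ⟨h1, h2⟩ := h
      rcases le_total k.1 i with h3 | h3 <;> rcases le_total k'.1 i with h4 | h4 <;>
        simp only [min_eq_left, min_eq_right, max_eq_left, max_eq_right, h3, h4] at h1 h2
      · exact h1
      · exact absurd h1 a
      · exact absurd h2 a
      · exact h2
    have h1 := hW.indep.precomp hinj
    have h2 := h1.comp (fun k : {k // k ≠ i} => fun z => (Real.sqrt N : ℂ) * cjj k.1 i z)
      (fun k => (cjj_meas _ _).const_mul _)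
    convert h2 using 2 with k
    ext ω
    simp only [Function.comp]
    rw [← cjj_eq (hW.herm ω)]
  rw [← hcol]
  rw [← indepFun_iff_map_prod_eq_prod_map_map (by fun_prop) (by fun_prop)]
  classical
  set S : Finset {p : Fin N × Fin N // p.1 ≤ p.2} :=
    Finset.univ.filter fun p => p.1.1 ≠ i ∧ p.1.2 ≠ i with hS
  set T : Finset {p : Fin N × Fin N // p.1 ≤ p.2} :=
    Finset.univ.filter fun p => ¬ (p.1.1 ≠ i ∧ p.1.2 ≠ i) with hT
  have hST : Disjoint S T := Finset.disjoint_filter_filter_not _ _ _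
  have hind := hW.indep.indepFun_finset₀ S T hST hZ
  have mS : ∀ k l : {k // k ≠ i}, ixp k.1 l.1 ∈ S := by
    intro k l
    simp only [hS, Finset.mem_filter, Finset.mem_univ, true_and, ixp]
    constructor
    · rcases min_choice k.1 l.1 with h | h <;> rw [h]
      · exact k.2
      · exact l.2
    · rcases max_choice k.1 l.1 with h | h <;> rw [h]
      · exact k.2
      · exact l.2
  have mT : ∀ k : {k // k ≠ i}, ixp k.1 i ∈ T := by
    intro k
    simp only [hT, Finset.mem_filter, Finset.mem_univ, true_and, ixp]
    rcases le_total k.1 i with h | h <;> simp [h]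
  have h3 := hind.comp
    (φ := fun u (k l : {k // k ≠ i}) => cjj k.1 l.1 (u ⟨ixp k.1 l.1, mS k l⟩))
    (ψ := fun u (k : {k // k ≠ i}) => (Real.sqrt N : ℂ) * cjj k.1 i (u ⟨ixp k.1 i, mT k⟩))
    (by
      refine measurable_pi_lambda _ fun k => measurable_pi_lambda _ fun l => ?_
      exact (cjj_meas _ _).comp (measurable_pi_apply _))
    (by
      refine measurable_pi_lambda _ fun k => ?_
      exact ((cjj_meas _ _).comp (measurable_pi_apply _)).const_mul _)
  convert h3 using 1
  · ext ω k l
    simp only [Function.comp]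
    rw [← cjj_eq (hW.herm ω)]
  · ext ω k
    simp only [Function.comp]
    rw [← cjj_eq (hW.herm ω)]

end Prob

section Prob2

theorem badQ_prob {δ : ℝ} (hδ : 0 < δ) (D D' : ℝ) : ∃ c C : ℝ, 0 < c ∧ 0 < C ∧
    ∀ (N : ℕ) (Ω : Type) (_ : MeasurableSpace Ω) (P : Measure Ω)
      (H : Ω → Matrix (Fin N) (Fin N) ℂ) (ν : Measure ℂ) (ν' : Measure ℝ),
      0 < N → IsWignerMatrix P N H ν ν' → CondC1 ν ν' δ D D' →
      ∀ (E : ℝ) (j : ℕ) (i : Fin N), P {ω | BadQ (H ω) E j i}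
        ≤ ENNReal.ofReal (C * Real.exp (-(c * Real.sqrt (N * (1 / 2) ^ j)))) := by
  obtain ⟨c, C, hc, hC, hq⟩ := qf_tail (D := D) hδ
  refine ⟨c / (19200 * Real.sqrt 41), C, by positivity, hC, ?_⟩
  intro N Ω _ P H ν ν' hN hW hC1 E j i
  have := hW.prob
  have haem := hW.aem hN
  have hNr : (0:ℝ) < N := by exact_mod_cast hN
  set η : ℝ := (1 / 2) ^ j with hη
  have hη0 : 0 < η := by positivity
  set z := zz E j with hz
  have hzim : z.im = η := by simp [hz, zz, hη]
  set s := Real.sqrt (41 * N / η) with hs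
  have hs0 : 0 < s := by positivity
  have hs2 : s ^ 2 = 41 * N / η := Real.sq_sqrt (by positivity)
  set T : Set (({k // k ≠ i} → {k // k ≠ i} → ℂ) × ({k // k ≠ i} → ℂ)) :=
    {p | ∑ k, ∑ l, ‖resol (Matrix.of p.1) z k l‖ ^ 2 ≤ s ^ 2 ∧
      (N : ℝ) / 19200 < ‖∑ k, ∑ l, star (p.2 k) * resol (Matrix.of p.1) z k l * p.2 l
        - ∑ k, resol (Matrix.of p.1) z k k‖} with hT
  have hTm : MeasurableSet T := by
    have hr : ∀ k l, Measurable fun p : ({k // k ≠ i} → {k // k ≠ i} → ℂ) × ({k // k ≠ i} → ℂ) =>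
      resol (Matrix.of p.1) z k l := fun k l => (resol_meas z k l).comp measurable_fst
    have ha : Measurable fun p : ({k // k ≠ i} → {k // k ≠ i} → ℂ) × ({k // k ≠ i} → ℂ) =>
      ∑ k, ∑ l, ‖resol (Matrix.of p.1) z k l‖ ^ 2 := by fun_prop
    have hb : Measurable fun p : ({k // k ≠ i} → {k // k ≠ i} → ℂ) × ({k // k ≠ i} → ℂ) =>
      ‖∑ k, ∑ l, star (p.2 k) * resol (Matrix.of p.1) z k l * p.2 l
        - ∑ k, resol (Matrix.of p.1) z k k‖ := by fun_prop
    exact (measurableSet_le ha measurable_const).inter (measurableSet_lt measurable_const hb)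
  set F : Ω → ({k // k ≠ i} → {k // k ≠ i} → ℂ) × ({k // k ≠ i} → ℂ) := fun ω =>
    ((fun (k l : {k // k ≠ i}) => H ω k l),
        (fun k : {k // k ≠ i} => (Real.sqrt N : ℂ) * H ω k i)) with hF
  have hFm : AEMeasurable F P := by simp only [hF]; fun_prop
  have hsub : {ω | BadQ (H ω) E j i} ⊆ F ⁻¹' T := by
    intro ω hω
    obtain ⟨h1, h2⟩ := hω
    have hm : Matrix.of (F ω).1 = minr (H ω) i := rfl
    have hHe := minr_herm (hW.herm ω) i
    show (∑ k, ∑ l, ‖resol (Matrix.of (F ω).1) z k l‖ ^ 2 ≤ s ^ 2) ∧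
      (N : ℝ) / 19200 < ‖∑ k, ∑ l, star ((F ω).2 k) * resol (Matrix.of (F ω).1) z k l * (F ω).2 l
        - ∑ k, resol (Matrix.of (F ω).1) z k k‖
    rw [hm]
    rw [Fintype.card_fin] at h1 h2
    rw [← hz] at h1 h2
    constructor
    · have h3 : η * ∑ k, ∑ l, ‖resol (minr (H ω) i) z k l‖ ^ 2
          = (∑ k, resol (minr (H ω) i) z k k).im := by
        rw [Finset.mul_sum, Complex.im_sum]
        refine Finset.sum_congr rfl fun k _ => ?_
        rw [← hzim]
        exact resol_ward_row hHe (by rw [hzim]; exact hη0.ne') k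
      rw [norm_div, Complex.norm_natCast, div_le_iff₀ hNr] at h1
      have h4 := (Complex.abs_im_le_norm (∑ k, resol (minr (H ω) i) z k k))
      have h5 := le_abs_self ((∑ k, resol (minr (H ω) i) z k k).im)
      rw [hs2, le_div_iff₀ hη0]
      linarith
    · have h6 : ∑ k, ∑ l, star ((F ω).2 k) * resol (minr (H ω) i) z k l * (F ω).2 l
          = (N : ℂ) * qform (H ω) z i := by
        simp only [qform, Finset.mul_sum, hF]
        refine Finset.sum_congr rfl fun k _ => Finset.sum_congr rfl fun l _ => ?_
        have h7 : (Real.sqrt N : ℂ) * (Real.sqrt N : ℂ) = N := by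
          rw [← Complex.ofReal_mul, Real.mul_self_sqrt hNr.le]; simp
        rw [star_mul', ← h7]
        simp only [Complex.star_def, Complex.conj_ofReal]
        ring
      have hNC : (N : ℂ) ≠ 0 := by exact_mod_cast hNr.ne'
      have h8 : (N : ℂ) * qform (H ω) z i - ∑ k, resol (minr (H ω) i) z k k
          = N * (qform (H ω) z i - (∑ k, resol (minr (H ω) i) z k k) / N) := by
        field_simp
      rw [h6, h8, norm_mul, Complex.norm_natCast]
      have := mul_lt_mul_of_pos_left h2 hNr
      linarith
  refine (measure_mono hsub).trans ?_
  rw [← Measure.map_apply_of_aemeasurable hFm hTm, hW.joint hN i]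
  have hgood := fun k : {k // k ≠ i} => hW.col_good hC1 hN k.1 i k.2
  have := fun k => (hgood k).prob
  rw [Measure.prod_apply hTm]
  have hY : IsProbabilityMeasure (P.map (fun ω => (fun (k l : {k // k ≠ i}) => H ω k l))) :=
    Measure.isProbabilityMeasure_map (by fun_prop)
  calc _ ≤ ∫⁻ _, ENNReal.ofReal (C * Real.exp (-(c * ((N : ℝ) / 19200 / s))))
        ∂(P.map (fun ω => (fun (k l : {k // k ≠ i}) => H ω k l))) := by
        apply lintegral_mono
        intro y
        by_cases hy : ∑ k, ∑ l, ‖resol (Matrix.of y) z k l‖ ^ 2 ≤ s ^ 2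
        · refine le_trans (measure_mono ?_) (hq _ hgood (fun k l => resol (Matrix.of y) z k l) s hs0 hy
            ((N : ℝ) / 19200))
          intro x hx
          exact hx.2
        · have : (Prod.mk y ⁻¹' T) = ∅ := by
            ext x
            simp only [Set.mem_preimage, Set.mem_empty_iff_false, iff_false]
            intro hx
            exact hy hx.1
          beta_reduce
          rw [this]; simp
    _ = ENNReal.ofReal (C * Real.exp (-(c * ((N : ℝ) / 19200 / s)))) := by simp
    _ ≤ _ := by
        apply le_of_eq
        congr 4
        have h9 : s = Real.sqrt 41 * (Real.sqrt N / Real.sqrt η) := by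
          rw [hs, mul_div_assoc, Real.sqrt_mul (by norm_num), Real.sqrt_div hNr.le]
        have h10 : (N : ℝ) = Real.sqrt N * Real.sqrt N := (Real.mul_self_sqrt hNr.le).symm
        have h11 : 0 < Real.sqrt N := by positivity
        have h12 : 0 < Real.sqrt η := by positivity
        have h13 : 0 < Real.sqrt 41 := by positivity
        rw [Real.sqrt_mul hNr.le, h9]
        generalize Real.sqrt 41 = u at *
        generalize Real.sqrt η = w at *
        rw [h10]
        generalize hv : Real.sqrt N = v at *
        rw [← h10, hv]
        field_simp
        rw [h10]; ring

theorem bad_prob {δ : ℝ} (hδ : 0 < δ) (D D' : ℝ) : ∃ c C : ℝ, 0 < c ∧ 0 < C ∧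
    ∀ (N : ℕ) (Ω : Type) (_ : MeasurableSpace Ω) (P : Measure Ω)
      (H : Ω → Matrix (Fin N) (Fin N) ℂ) (ν : Measure ℂ) (ν' : Measure ℝ),
      0 < N → IsWignerMatrix P N H ν ν' → CondC1 ν ν' δ D D' →
      ∀ (E : ℝ) (j : ℕ) (i : Fin N), P {ω | Bad (H ω) E j i}
        ≤ ENNReal.ofReal (C * Real.exp (-(c * Real.sqrt (N * (1 / 2) ^ j)))) := by
  obtain ⟨c, C, hc, hC, hq⟩ := badQ_prob hδ D D'
  set d := δ / 19200 ^ 2 with hd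
  have hd0 : 0 < d := by positivity
  refine ⟨min c d, C + |D'|, lt_min hc hd0, by positivity, ?_⟩
  intro N Ω _ P H ν ν' hN hW hC1 E j i
  have hNr : (0:ℝ) < N := by exact_mod_cast hN
  have hN1 : (1:ℝ) ≤ N := by exact_mod_cast hN
  have haem := hW.aem hN
  set L : ℝ := N * (1 / 2) ^ j with hL
  have hL0 : 0 < L := by positivity
  have hLN : L ≤ N := by
    have : ((1:ℝ) / 2) ^ j ≤ 1 := pow_le_one₀ (by norm_num) (by norm_num)
    rw [hL]; nlinarith
  have h1 : P {ω | 1 / 19200 < ‖H ω i i‖} ≤ ENNReal.ofReal (|D'| * Real.exp (-(d * N))) := by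
    set g : ℝ → ℝ≥0∞ := fun x => ENNReal.ofReal (Real.exp (δ * x ^ 2)) with hg
    have hgm : Measurable g := by simp only [hg]; fun_prop
    have hX : AEMeasurable (fun ω => Real.sqrt N * (H ω i i).re) P :=
      (Complex.measurable_re.comp_aemeasurable (haem i i)).const_mul _
    have h2 : ∫⁻ ω, g (Real.sqrt N * (H ω i i).re) ∂P ≤ ENNReal.ofReal |D'| := by
      rw [← lintegral_map' (f := g) hgm.aemeasurable hX, hW.diag i]
      exact hC1.2.2.trans (ENNReal.ofReal_le_ofReal (le_abs_self _))
    have h3 : {ω | 1 / 19200 < ‖H ω i i‖} ⊆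
        {ω | ENNReal.ofReal (Real.exp (d * N)) ≤ g (Real.sqrt N * (H ω i i).re)} := by
      intro ω hω
      simp only [Set.mem_ofPred_eq] at hω ⊢
      simp only [hg]
      apply ENNReal.ofReal_le_ofReal
      apply Real.exp_le_exp.mpr
      have e : H ω i i = ((H ω i i).re : ℂ) := by
        apply Complex.ext <;> simp [hW.diag_real]
      rw [e, Complex.norm_real, Real.norm_eq_abs] at hω
      rw [mul_pow, Real.sq_sqrt hNr.le, ← sq_abs (H ω i i).re, hd]
      have : (1 / 19200 : ℝ) ^ 2 ≤ |(H ω i i).re| ^ 2 := by gcongr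
      have h4 : 0 < δ * N := by positivity
      calc δ / 19200 ^ 2 * N = δ * N * (1 / 19200) ^ 2 := by ring
        _ ≤ δ * N * |(H ω i i).re| ^ 2 := by gcongr
        _ = _ := by ring
    have h4 : ENNReal.ofReal (Real.exp (d * N)) * P {ω | 1 / 19200 < ‖H ω i i‖}
        ≤ ENNReal.ofReal |D'| := by
      refine le_trans ?_ h2
      refine le_trans (mul_le_mul_right (measure_mono h3) _) ?_
      exact mul_meas_ge_le_lintegral₀ (hgm.comp_aemeasurable hX) _
    have hne : ENNReal.ofReal (Real.exp (d * N)) ≠ 0 := by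
      simp [Real.exp_pos]
    have h5 := (ENNReal.le_div_iff_mul_le (Or.inl hne) (Or.inl ENNReal.ofReal_ne_top)).mpr
      ((mul_comm _ _).le.trans h4)
    refine h5.trans (le_of_eq ?_)
    rw [← ENNReal.ofReal_div_of_pos (Real.exp_pos _)]
    congr 1
    rw [div_eq_mul_inv, ← Real.exp_neg]
  have hsub : {ω | Bad (H ω) E j i} ⊆ {ω | 1 / 19200 < ‖H ω i i‖} ∪ {ω | BadQ (H ω) E j i} := by
    intro ω hω
    exact hω
  refine (measure_mono hsub).trans ((measure_union_le _ _).trans ?_)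
  have h6 := hq N Ω _ P H ν ν' hN hW hC1 E j i
  rw [← hL] at h6
  have hsq : Real.sqrt L ≤ N := by
    rw [Real.sqrt_le_left hNr.le]; nlinarith
  have hs0 := Real.sqrt_nonneg L
  rw [add_mul, add_comm, ENNReal.ofReal_add (by positivity) (by positivity)]
  refine add_le_add (h6.trans ?_) (h1.trans ?_)
  · gcongr; exact min_le_left _ _
  · gcongr; exact min_le_right _ _

end Prob2

section Fin1

/-- recursion for the weighted sum of probabilities -/
def qsum (p : ℕ → ℝ) : ℕ → ℝ
  | 0 => 0
  | j + 1 => 2 * qsum p j + p (j + 1)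

theorem qsum_nonneg (p : ℕ → ℝ) (hp : ∀ j, 0 ≤ p j) (j : ℕ) : 0 ≤ qsum p j := by
  induction j with
  | zero => simp [qsum]
  | succ j ih => rw [qsum]; have := hp (j + 1); linarith

theorem Rr_major {Ω : Type} [MeasurableSpace Ω] (P : Measure Ω) (b : Ω → ℕ → Prop) (p : ℕ → ℝ)
    (hp : ∀ j, 0 ≤ p j) (hb : ∀ j, P {ω | b ω j} ≤ ENNReal.ofReal (p j)) (J : ℕ) :
    ∃ g : Ω → ℝ≥0∞, Measurable g ∧ (∀ ω, ENNReal.ofReal (Rr (b ω) J) ≤ g ω) ∧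
      ∫⁻ ω, g ω ∂P ≤ ENNReal.ofReal (qsum p J) := by
  induction J with
  | zero => exact ⟨fun _ => 0, measurable_const, fun ω => by simp [Rr], by simp⟩
  | succ J ih =>
    obtain ⟨g, hg, h1, h2⟩ := ih
    set S := toMeasurable P {ω | b ω (J + 1)} with hS
    have hSm : MeasurableSet S := measurableSet_toMeasurable _ _
    refine ⟨fun ω => 2 * g ω + S.indicator (fun _ => 1) ω, ?_, ?_, ?_⟩
    · exact (hg.const_mul _).add (measurable_const.indicator hSm)
    · intro ω
      rw [Rr, ENNReal.ofReal_add (by have := Rr_nonneg (b ω) J; positivity) (by split_ifs <;> simp),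
        ENNReal.ofReal_mul (by norm_num)]
      refine add_le_add ?_ ?_
      · simp only [ENNReal.ofReal_ofNat]
        gcongr
        exact h1 ω
      · split_ifs with h
        · have : ω ∈ S := subset_toMeasurable P _ h
          simp [this]
        · simp
    · rw [lintegral_add_left (hg.const_mul _), lintegral_const_mul _ hg, lintegral_indicator hSm,
        qsum, ENNReal.ofReal_add (by have := qsum_nonneg p hp J; positivity) (hp _),
        ENNReal.ofReal_mul (by norm_num)]
      simp only [ENNReal.ofReal_ofNat, lintegral_const, Measure.restrict_apply, MeasurableSet.univ,
        Set.univ_inter, one_mul]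
      rw [hS, measure_toMeasurable]
      gcongr
      exact hb _

theorem qsum_bound {c C n : ℝ} (hc : 0 < c) (hC : 0 < C) (hn : 0 < n) (J : ℕ)
    (hL : 10 ≤ c * Real.sqrt (n * (1 / 2) ^ J)) :
    qsum (fun j => C * Real.exp (-(c * Real.sqrt (n * (1 / 2) ^ j)))) J
      ≤ 2 * C * Real.exp (-(c / 2 * Real.sqrt (n * (1 / 2) ^ J))) := by
  induction J with
  | zero => simp only [qsum]; positivity
  | succ J ih =>
    set s := Real.sqrt (n * (1 / 2) ^ (J + 1)) with hs
    have e : Real.sqrt (n * (1 / 2) ^ J) = Real.sqrt 2 * s := by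
      rw [hs, ← Real.sqrt_mul (by norm_num)]; congr 1; ring
    have h2 : (1.4 : ℝ) ≤ Real.sqrt 2 := Real.le_sqrt_of_sq_le (by norm_num)
    have hs0 : 0 ≤ s := Real.sqrt_nonneg _
    rw [e] at ih
    have h3 : c * s ≤ c * (Real.sqrt 2 * s) := by
      gcongr; nlinarith
    have ih' := ih (by linarith)
    rw [qsum, ← hs]
    have hcs : 0 ≤ c * s := by positivity
    have hq : Real.exp (-(2:ℝ)) ≤ 1 / 4 := by
      rw [Real.exp_neg, inv_eq_one_div]
      have : (4:ℝ) ≤ Real.exp 2 := by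
        have h := Real.exp_one_gt_d9
        have e2 : Real.exp 2 = Real.exp 1 * Real.exp 1 := by rw [← Real.exp_add]; norm_num
        rw [e2]; nlinarith
      gcongr
    have h4 : Real.exp (-(c / 2 * (Real.sqrt 2 * s))) ≤ 1 / 4 * Real.exp (-(c / 2 * s)) := by
      calc _ ≤ Real.exp (-2 + -(c / 2 * s)) := by
            apply Real.exp_le_exp.mpr
            nlinarith
        _ = Real.exp (-2) * Real.exp (-(c / 2 * s)) := Real.exp_add _ _
        _ ≤ _ := by gcongr
    have h5 : Real.exp (-(c * s)) ≤ Real.exp (-(c / 2 * s)) := by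
      apply Real.exp_le_exp.mpr; linarith
    nlinarith [mul_le_mul_of_nonneg_left h4 hC.le, mul_le_mul_of_nonneg_left h5 hC.le]

theorem sumR_prob {Ω : Type} [MeasurableSpace Ω] (P : Measure Ω) {N : ℕ} (hN : 0 < N)
    (b : Ω → Fin N → ℕ → Prop) (p : ℕ → ℝ) (hp : ∀ j, 0 ≤ p j)
    (hb : ∀ i j, P {ω | b ω i j} ≤ ENNReal.ofReal (p j)) (J : ℕ) :
    P {ω | (N : ℝ) / 120 < ∑ i, Rr (b ω i) J} ≤ ENNReal.ofReal (120 * qsum p J) := by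
  have hNr : (0:ℝ) < N := by exact_mod_cast hN
  choose g hg h1 h2 using fun i => Rr_major P (fun ω => b ω i) p hp (hb i) J
  have hsub : {ω | (N : ℝ) / 120 < ∑ i, Rr (b ω i) J}
      ⊆ {ω | ENNReal.ofReal ((N : ℝ) / 120) ≤ ∑ i, g i ω} := by
    intro ω hω
    simp only [Set.mem_ofPred_eq] at hω ⊢
    calc _ ≤ ENNReal.ofReal (∑ i, Rr (b ω i) J) := ENNReal.ofReal_le_ofReal hω.le
      _ = ∑ i, ENNReal.ofReal (Rr (b ω i) J) :=
        ENNReal.ofReal_sum_of_nonneg fun i _ => Rr_nonneg _ _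
      _ ≤ _ := Finset.sum_le_sum fun i _ => h1 i ω
  have h3 : ENNReal.ofReal ((N : ℝ) / 120) * P {ω | (N : ℝ) / 120 < ∑ i, Rr (b ω i) J}
      ≤ ENNReal.ofReal (N * qsum p J) := by
    refine le_trans (mul_le_mul_right (measure_mono hsub) _) ?_
    refine (mul_meas_ge_le_lintegral (Finset.measurable_sum _ fun i _ => hg i) _).trans ?_
    rw [lintegral_finsetSum _ fun i _ => hg i]
    refine (Finset.sum_le_sum fun i _ => h2 i).trans ?_
    simp only [Finset.sum_const, Finset.card_univ, Fintype.card_fin, nsmul_eq_mul]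
    rw [ENNReal.ofReal_mul hNr.le, ENNReal.ofReal_natCast]
  have hne : ENNReal.ofReal ((N : ℝ) / 120) ≠ 0 := by
    simp; exact hN
  have h5 := (ENNReal.le_div_iff_mul_le (Or.inl hne) (Or.inl ENNReal.ofReal_ne_top)).mpr
      ((mul_comm _ _).le.trans h3)
  refine h5.trans (le_of_eq ?_)
  rw [← ENNReal.ofReal_div_of_pos (by positivity)]
  congr 1
  field_simp

end Fin1

set_option maxHeartbeats 1000000 in
/-- **Delocalization of a single eigenvector coordinate.** -/
theorem stmt_2 :
    ∀ κ K δ₀ D D' : ℝ, 0 < κ → 0 < K →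
    ∃ C c : ℝ, 0 < C ∧ 0 < c ∧
    ∀ (N : ℕ) (Ω : Type) (_ : MeasurableSpace Ω) (P : Measure Ω)
      (H : Ω → Matrix (Fin N) (Fin N) ℂ) (ν : Measure ℂ) (ν' : Measure ℝ)
      (hN : 2 ≤ N),
      IsWignerMatrix P N H ν ν' →
      CondC1 ν ν' δ₀ D D' →
      ∀ a b : ℝ, -2 + κ ≤ a → a ≤ b → b ≤ 2 - κ → b - a ≤ K / N →
      ∀ M : ℝ, 0 ≤ M →
        P {ω | ∃ μ ∈ Set.Icc a b, ∃ v : Fin N → ℂ,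
            (∑ i, ‖v i‖ ^ 2) = 1 ∧
            (H ω).mulVec v = (μ : ℂ) • v ∧
            M / Real.sqrt N ≤ ‖v ⟨0, by omega⟩‖}
          ≤ ENNReal.ofReal (C * Real.exp (-(c * Real.sqrt M))) := by
  intro κ K δ₀ D D' hκ hK
  by_cases hδ : 0 < δ₀
  swap
  · refine ⟨1, 1, one_pos, one_pos, ?_⟩
    intro N Ω _ P H ν ν' hN hW hC
    exact absurd hC.1 hδ
  obtain ⟨c, C, hc, hC, hbad⟩ := bad_prob hδ D D'
  set T : ℝ := 19200 + K + (10 / c) ^ 2 with hT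
  have hTp : 0 < T := by positivity
  set M0 := Real.sqrt (80 * T) with hM0
  have hM0p : 0 < M0 := by positivity
  have hM0sq : M0 ^ 2 = 80 * T := Real.sq_sqrt (by positivity)
  refine ⟨241 * C + Real.exp (c / 18 * Real.sqrt M0), c / 18, by positivity, by positivity, ?_⟩
  intro N Ω _ P H ν ν' hN hW hC1 a b ha hab hb hbK M hM
  have := hW.prob
  have hN0 : 0 < N := by omega
  have hNr : (0:ℝ) < N := by exact_mod_cast hN0
  have hsN : 0 < Real.sqrt N := by positivity
  rcases lt_or_ge M M0 with hMlt | hMge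
  · refine prob_le_one.trans ?_
    rw [ENNReal.one_le_ofReal]
    have h1 : Real.sqrt M ≤ Real.sqrt M0 := Real.sqrt_le_sqrt hMlt.le
    have h2 : 1 = Real.exp (c / 18 * Real.sqrt M0) * Real.exp (-(c / 18 * Real.sqrt M0)) := by
      rw [← Real.exp_add]; simp
    have h3 : Real.exp (-(c / 18 * Real.sqrt M0)) ≤ Real.exp (-(c / 18 * Real.sqrt M)) := by
      gcongr
    have h4 := Real.exp_pos (c / 18 * Real.sqrt M0)
    calc (1:ℝ) ≤ Real.exp (c / 18 * Real.sqrt M0) * Real.exp (-(c / 18 * Real.sqrt M)) := by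
          rw [h2]; gcongr
      _ ≤ _ := by gcongr; linarith [hC]
  have hMpos : 0 < M := lt_of_lt_of_le hM0p hMge
  have hMsq : 80 * T ≤ M ^ 2 := by rw [← hM0sq]; gcongr
  have hM1 : 1 ≤ M := by
    have : 0 ≤ (10 / c) ^ 2 := by positivity
    nlinarith
  rcases lt_or_ge (N : ℝ) (M ^ 2) with hMN | hMN
  · have hempty : {ω | ∃ μ ∈ Set.Icc a b, ∃ v : Fin N → ℂ,
            (∑ i, ‖v i‖ ^ 2) = 1 ∧
            (H ω).mulVec v = (μ : ℂ) • v ∧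
            M / Real.sqrt N ≤ ‖v ⟨0, by omega⟩‖} = ∅ := by
      ext ω
      simp only [Set.mem_ofPred_eq, Set.mem_empty_iff_false, iff_false]
      rintro ⟨μ, _, v, hv, _, hv0⟩
      have h1 : ‖v ⟨0, by omega⟩‖ ^ 2 ≤ 1 := by
        rw [← hv]
        exact Finset.single_le_sum (f := fun i => ‖v i‖ ^ 2) (fun i _ => sq_nonneg _) (Finset.mem_univ _)
      have h2 : (M / Real.sqrt N) ^ 2 ≤ 1 := le_trans (by gcongr) h1
      rw [div_pow, Real.sq_sqrt hNr.le, div_le_one hNr] at h2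
      linarith
    rw [hempty]; simp
  -- choice of scale
  obtain ⟨n, hn1, hn2⟩ := exists_nat_pow_near_of_lt_one (x := M ^ 2 / 40 / N) (y := (1 / 2 : ℝ))
    (by positivity) (by rw [div_div, div_le_one (by positivity)]; nlinarith) (by norm_num) (by norm_num)
  set J := n + 1 with hJ
  set L : ℝ := N * (1 / 2) ^ J with hL
  have hL1 : L < M ^ 2 / 40 := by
    rw [lt_div_iff₀ hNr] at hn1
    rw [hL]; linarith
  have hL2 : M ^ 2 / 80 ≤ L := by
    rw [div_le_iff₀ hNr] at hn2
    have e : L = (1 / 2) ^ n * N / 2 := by rw [hL, hJ]; ring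
    rw [e]; linarith
  have hLT : T ≤ L := by linarith
  have hcsq : 0 ≤ (10 / c) ^ 2 := by positivity
  have hcL : 10 ≤ c * Real.sqrt L := by
    have : 10 / c ≤ Real.sqrt L := Real.le_sqrt_of_sq_le (by linarith)
    rw [div_le_iff₀ hc] at this
    linarith
  have hbound := fun i j => hbad N Ω _ P H ν ν' hN0 hW hC1 a j i
  have hS := sumR_prob P hN0 (fun ω i j => Bad (H ω) a j i)
    (fun j => C * Real.exp (-(c * Real.sqrt (N * (1 / 2) ^ j)))) (fun j => by positivity) hbound J
  have hq := qsum_bound hc hC hNr J hcL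
  have hB0 := hbound ⟨0, by omega⟩ J
  rw [← hL] at hq hB0
  have hsub : {ω | ∃ μ ∈ Set.Icc a b, ∃ v : Fin N → ℂ,
            (∑ i, ‖v i‖ ^ 2) = 1 ∧
            (H ω).mulVec v = (μ : ℂ) • v ∧
            M / Real.sqrt N ≤ ‖v ⟨0, by omega⟩‖} ⊆
      {ω | (N : ℝ) / 120 < ∑ i, Rr (fun j => Bad (H ω) a j i) J} ∪
        {ω | Bad (H ω) a J ⟨0, by omega⟩} := by
    rintro ω ⟨μ, hμ, v, hv, hHv, hv0⟩
    by_contra hcon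
    simp only [Set.mem_union, Set.mem_ofPred_eq, not_or, not_lt] at hcon
    obtain ⟨hR, hnb⟩ := hcon
    have : Nonempty (Fin N) := ⟨⟨0, by omega⟩⟩
    have hdet := det_main (hW.herm ω) (E := a) (abs_le.mpr ⟨by linarith, by linarith⟩)
      (J := J) (by omega) (by rw [Fintype.card_fin, ← hL]; linarith)
      (by rw [Fintype.card_fin]; exact hR) ⟨0, by omega⟩ hnb
    set η : ℝ := (1 / 2) ^ J with hη
    have hη0 : 0 < η := by positivity
    have him : (zz a J).im = η := rfl
    have hre : (zz a J).re = a := rfl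
    have heig := resol_eigvec (hW.herm ω) (z := zz a J) (by rw [him]; exact hη0) ⟨0, by omega⟩ hv hHv
    rw [him] at heig
    have hKη : K / N ≤ η := by
      rw [div_le_iff₀ hNr, mul_comm, ← hL]; linarith
    have hdist : ‖(μ : ℂ) - zz a J‖ ^ 2 ≤ 2 * η ^ 2 := by
      rw [← Complex.normSq_eq_norm_sq, Complex.normSq_apply, Complex.sub_re, Complex.sub_im, him, hre,
        Complex.ofReal_re, Complex.ofReal_im]
      have h1 := hμ.1
      have h2 := hμ.2
      have h3 : (μ - a) ^ 2 ≤ η ^ 2 := by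
        apply pow_le_pow_left₀ <;> linarith
      linarith [h3, show (μ - a) * (μ - a) + (0 - η) * (0 - η) = (μ - a) ^ 2 + η ^ 2 by ring]
    have h1 : (M / Real.sqrt N) ^ 2 ≤ ‖v ⟨0, by omega⟩‖ ^ 2 := by gcongr
    rw [div_pow, Real.sq_sqrt hNr.le] at h1
    have h2 : η * (M ^ 2 / N) ≤ 2 * η ^ 2 * 10 := by
      calc _ ≤ η * ‖v ⟨0, by omega⟩‖ ^ 2 := by gcongr
        _ ≤ _ := heig
        _ ≤ _ := by gcongr
    have h3 : M ^ 2 / N ≤ 20 * η := by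
      refine le_of_mul_le_mul_left ?_ hη0
      calc _ ≤ _ := h2
        _ = _ := by ring
    rw [div_le_iff₀ hNr] at h3
    have h4 : 20 * η * N = 20 * L := by rw [hL]; ring
    have h5 : 0 < M ^ 2 := by positivity
    rw [h4] at h3
    linarith
  refine (measure_mono hsub).trans ((measure_union_le _ _).trans ((add_le_add hS hB0).trans ?_))
  have hqn := qsum_nonneg (fun j => C * Real.exp (-(c * Real.sqrt (N * (1 / 2) ^ j))))
    (fun j => by positivity) J
  rw [← ENNReal.ofReal_add (by positivity) (by positivity)]
  apply ENNReal.ofReal_le_ofReal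
  have hsL : M / 9 ≤ Real.sqrt L := Real.le_sqrt_of_sq_le (by nlinarith)
  have hsM : Real.sqrt M ≤ M := by
    rw [Real.sqrt_le_left hM]; nlinarith
  have h1 : Real.exp (-(c / 2 * Real.sqrt L)) ≤ Real.exp (-(c / 18 * Real.sqrt M)) := by
    apply Real.exp_le_exp.mpr
    have : c * Real.sqrt M ≤ c * (9 * Real.sqrt L) := by gcongr; linarith
    linarith
  have h2 : Real.exp (-(c * Real.sqrt L)) ≤ Real.exp (-(c / 2 * Real.sqrt L)) := by
    apply Real.exp_le_exp.mpr
    have : 0 ≤ c * Real.sqrt L := by positivity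
    linarith
  have h3 := Real.exp_pos (c / 18 * Real.sqrt M0)
  have h4 := Real.exp_pos (-(c / 18 * Real.sqrt M))
  calc _ ≤ 120 * (2 * C * Real.exp (-(c / 18 * Real.sqrt M)))
        + C * Real.exp (-(c / 18 * Real.sqrt M)) := by
        refine add_le_add (mul_le_mul_of_nonneg_left (hq.trans ?_) (by norm_num))
          (mul_le_mul_of_nonneg_left (h2.trans h1) hC.le)
        exact mul_le_mul_of_nonneg_left h1 (by positivity)
    _ = 241 * C * Real.exp (-(c / 18 * Real.sqrt M)) := by ring
    _ ≤ _ := by gcongr; linarith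

end
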